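/- arXiv:2511.06334 — 3 statements merged into one kernel-verified Lean document; each statement's English description precedes it below -/
import Mathlib

section
/- Let N ≥ 2, 0 < s < 1 < p < ∞, N > sp, and let t, m ≥ 0 satisfy condition (M) and t(N − sp) + m(N − (sp − p + 1)) < N(p − 1). Let u : ℝ^N → ℝ be nonnegative and continuously differentiable, and suppose that for every x ∈ ℝ^N the fractional p-Laplacian (−Δ_p)^s u(x) exists in the principal-value sense with a value L(x) ∈ ℝ satisfying L(x) ≥ u(x)^t · ‖∇u(x)‖^m. Then u is constant. -/
open MeasureTheory Filter Set

/-- `(-Δ_p)^s u(x)` exists in the principal-value sense with value `L`: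
for every `r > 0` the integrand is integrable on `{y : |x - y| > r}`, and the
truncated integrals converge to `L` as `r → 0⁺`. -/
noncomputable def pvFracPLap (N : ℕ) (s p : ℝ) (u : EuclideanSpace ℝ (Fin N) → ℝ)
    (x : EuclideanSpace ℝ (Fin N)) (L : ℝ) : Prop :=
  (∀ r : ℝ, 0 < r →
    IntegrableOn
      (fun y => |u x - u y| ^ (p - 2) * (u x - u y) * ‖x - y‖ ^ (-((N : ℝ) + s * p)))
      {y | r < ‖x - y‖} volume) ∧
  Tendsto
    (fun r : ℝ => ∫ y in {y : EuclideanSpace ℝ (Fin N) | r < ‖x - y‖},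
        |u x - u y| ^ (p - 2) * (u x - u y) * ‖x - y‖ ^ (-((N : ℝ) + s * p)))
    (nhdsWithin 0 (Set.Ioi 0)) (nhds L)

lemma abs_det_inversion {N : ℕ} (x : EuclideanSpace ℝ (Fin N)) :
    |((1 / dist x 0) ^ 2 • ((Submodule.span ℝ {x - 0})ᗮ.reflection :
      EuclideanSpace ℝ (Fin N) →L[ℝ] EuclideanSpace ℝ (Fin N))).det| = (‖x‖⁻¹) ^ (2 * N) := by
  rw [ContinuousLinearMap.det, ContinuousLinearMap.toLinearMap_smul, LinearMap.det_smul, abs_mul]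
  have h : |LinearMap.det ((Submodule.span ℝ {x - 0})ᗮ.reflection.toLinearMap)| = 1 := by
    rw [Submodule.det_reflection]; simp
  have h2 : (((Submodule.span ℝ {x - 0})ᗮ.reflection :
      EuclideanSpace ℝ (Fin N) →L[ℝ] EuclideanSpace ℝ (Fin N))).toLinearMap =
        (Submodule.span ℝ {x - 0})ᗮ.reflection.toLinearMap := rfl
  rw [h2, h]
  simp [pow_mul]

lemma setIntegral_inversion {N : ℕ} {S : Set (EuclideanSpace ℝ (Fin N))} (hS : MeasurableSet S)
    (h0 : ∀ x ∈ S, x ≠ 0) (F : EuclideanSpace ℝ (Fin N) → ℝ) :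
    ∫ y in EuclideanGeometry.inversion 0 1 '' S, F y =
      ∫ y in S, (‖y‖⁻¹) ^ (2 * N) * F (EuclideanGeometry.inversion 0 1 y) := by
  rw [integral_image_eq_integral_abs_det_fderiv_smul volume hS
    (fun x hx => (EuclideanGeometry.hasFDerivAt_inversion (h0 x hx)).hasFDerivWithinAt)
    (EuclideanGeometry.inversion_injective 0 one_ne_zero).injOn]
  simp_rw [abs_det_inversion, smul_eq_mul]

lemma integrableOn_inversion {N : ℕ} {S : Set (EuclideanSpace ℝ (Fin N))} (hS : MeasurableSet S)
    (h0 : ∀ x ∈ S, x ≠ 0) (F : EuclideanSpace ℝ (Fin N) → ℝ) :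
    IntegrableOn F (EuclideanGeometry.inversion 0 1 '' S) ↔
      IntegrableOn (fun y => (‖y‖⁻¹) ^ (2 * N) * F (EuclideanGeometry.inversion 0 1 y)) S := by
  rw [integrableOn_image_iff_integrableOn_abs_det_fderiv_smul volume hS
    (fun x hx => (EuclideanGeometry.hasFDerivAt_inversion (h0 x hx)).hasFDerivWithinAt)
    (EuclideanGeometry.inversion_injective 0 one_ne_zero).injOn]
  simp_rw [abs_det_inversion, smul_eq_mul]

lemma norm_inversion_zero_one {N : ℕ} (y : EuclideanSpace ℝ (Fin N)) :
    ‖EuclideanGeometry.inversion 0 1 y‖ = ‖y‖⁻¹ := by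
  have := EuclideanGeometry.dist_inversion_center 0 y 1
  simpa using this

lemma norm_sub_inversion_zero_one {N : ℕ} {e y : EuclideanSpace ℝ (Fin N)} (he : ‖e‖ = 1)
    (hy : y ≠ 0) : ‖e - EuclideanGeometry.inversion 0 1 y‖ = ‖y‖⁻¹ * ‖e - y‖ := by
  have he0 : e ≠ 0 := by rintro rfl; simp at he
  have h1 : EuclideanGeometry.inversion 0 1 e = e :=
    EuclideanGeometry.inversion_of_mem_sphere (by simpa using he)
  have := EuclideanGeometry.dist_inversion_inversion he0 hy 1
  rw [h1] at this
  simpa [dist_eq_norm, he] using this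

lemma inversion_image_outer {N : ℕ} {e : EuclideanSpace ℝ (Fin N)} (he : ‖e‖ = 1) (r : ℝ) :
    EuclideanGeometry.inversion 0 1 '' {y | (0 < ‖y‖ ∧ ‖y‖ < 1) ∧ r * ‖y‖ < ‖e - y‖} =
      {y | 1 < ‖y‖ ∧ r < ‖e - y‖} := by
  ext z
  constructor
  · rintro ⟨y, ⟨⟨h0, h1⟩, h2⟩, rfl⟩
    refine ⟨?_, ?_⟩
    · rw [norm_inversion_zero_one]
      exact (one_lt_inv₀ h0).2 h1
    · rw [norm_sub_inversion_zero_one he (norm_pos_iff.1 h0), inv_mul_eq_div, lt_div_iff₀ h0]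
      exact h2
  · rintro ⟨h1, h2⟩
    have hz : 0 < ‖z‖ := by linarith
    refine ⟨EuclideanGeometry.inversion 0 1 z, ⟨⟨?_, ?_⟩, ?_⟩,
      EuclideanGeometry.inversion_inversion 0 one_ne_zero z⟩
    · rw [norm_inversion_zero_one]; positivity
    · rw [norm_inversion_zero_one]; exact inv_lt_one_of_one_lt₀ h1
    · rw [norm_inversion_zero_one, norm_sub_inversion_zero_one he (norm_pos_iff.1 hz), mul_comm]
      gcongr

lemma integrableOn_ball_norm_rpow {N : ℕ} (hN : 1 ≤ N) {a : ℝ} (ha : -(N : ℝ) < a) {R : ℝ}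
    (hR : 0 < R) :
    IntegrableOn (fun y : EuclideanSpace ℝ (Fin N) => ‖y‖ ^ a) (Metric.ball 0 R) := by
  have : Nonempty (Fin N) := ⟨⟨0, hN⟩⟩
  refine (integrableOn_fun_norm_addHaar (f := fun ρ : ℝ => ρ ^ a) volume).2 ?_
  have h : IntegrableOn (fun y : ℝ => y ^ (a + (N - 1 : ℕ))) (Ioo 0 R) := by
    rw [intervalIntegral.integrableOn_Ioo_rpow_iff hR, Nat.cast_sub hN]
    push_cast
    linarith
  refine h.congr_fun (fun y hy => ?_) measurableSet_Ioo
  simp only [smul_eq_mul, finrank_euclideanSpace, Fintype.card_fin]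
  rw [Real.rpow_add hy.1, Real.rpow_natCast, mul_comm]

lemma integral_ball_norm_rpow {N : ℕ} {a ε : ℝ} (hε : 0 < ε) :
    ∫ y in Metric.ball (0 : EuclideanSpace ℝ (Fin N)) ε, ‖y‖ ^ a =
      ε ^ (a + N) * ∫ y in Metric.ball (0 : EuclideanSpace ℝ (Fin N)) 1, ‖y‖ ^ a := by
  have h := Measure.setIntegral_comp_smul_of_pos volume
    (fun y : EuclideanSpace ℝ (Fin N) => ‖y‖ ^ a) (Metric.ball 0 1) hε
  rw [smul_ball hε.ne'] at h
  simp only [smul_zero, Real.norm_of_nonneg hε.le, mul_one, finrank_euclideanSpace,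
    Fintype.card_fin, smul_eq_mul, norm_smul] at h
  simp_rw [Real.mul_rpow hε.le (norm_nonneg _), integral_const_mul] at h
  rw [Real.rpow_add hε, Real.rpow_natCast, mul_right_comm, h]
  field_simp

lemma volume_real_shell_le {N : ℕ} (e : EuclideanSpace ℝ (Fin N)) {r : ℝ}
    (hr : 0 < r) (hr1 : r < 1) :
    volume.real (Metric.closedBall e r \ Metric.closedBall e (r * (1 - r))) ≤
      N * volume.real (Metric.closedBall (0 : EuclideanSpace ℝ (Fin N)) 1) * r ^ (N + 1) := by
  have h1 : 0 ≤ r * (1 - r) := mul_nonneg hr.le (by linarith)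
  rw [measureReal_sdiff (Metric.closedBall_subset_closedBall (by nlinarith))
    measurableSet_closedBall measure_closedBall_lt_top.ne,
    Measure.addHaar_real_closedBall' volume e hr.le,
    Measure.addHaar_real_closedBall' volume e h1]
  simp only [finrank_euclideanSpace, Fintype.card_fin]
  have hb := one_add_mul_le_pow (a := -r) (by linarith) N
  have hv : 0 ≤ volume.real (Metric.closedBall (0 : EuclideanSpace ℝ (Fin N)) 1) :=
    measureReal_nonneg
  have hrN : 0 ≤ r ^ N := by positivity
  have h2 : r ^ N * (1 - (1 + -r) ^ N) ≤ r ^ N * (N * r) := by gcongr; linarith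
  have h3 := mul_le_mul_of_nonneg_right h2 hv
  rw [mul_pow]
  have h4 : (1 - r) ^ N = (1 + -r) ^ N := by ring
  rw [h4, pow_succ]
  nlinarith

lemma radial_pv_reduction {N : ℕ} (hN : 1 ≤ N) {p σ θ B : ℝ} (hp : 1 < p) (hσ : 0 < σ)
    (hθ : θ < N) (hB : 0 ≤ B) {φ : ℝ → ℝ} (hφ : Measurable φ)
    (hin : ∀ ρ, 0 < ρ → ρ < 1 → |φ ρ| ≤ B)
    (hout0 : ∀ ρ, 0 < ρ → ρ < 1 → 0 ≤ φ ρ⁻¹)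
    (hout : ∀ ρ, 0 < ρ → ρ < 1 → φ ρ⁻¹ * ρ ^ (σ - N) ≤ B * ρ ^ (-θ))
    (hlip : ∀ ρ, 1 / 2 ≤ ρ → ρ < 1 → φ ρ⁻¹ ≤ B * (1 - ρ) ^ (p - 1)) :
    ∃ C, ∀ (e : EuclideanSpace ℝ (Fin N)), ‖e‖ = 1 → ∀ r : ℝ, 0 < r → r < 1 / 2 →
      IntegrableOn (fun y => φ ‖y‖ * ‖e - y‖ ^ (-((N : ℝ) + σ))) {y | r < ‖e - y‖} ∧
      IntegrableOn (fun y => (φ ‖y‖ + φ ‖y‖⁻¹ * ‖y‖ ^ (σ - N)) * ‖e - y‖ ^ (-((N : ℝ) + σ)))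
        {y | (0 < ‖y‖ ∧ ‖y‖ < 1) ∧ r < ‖e - y‖} ∧
      ∫ y in {y | r < ‖e - y‖}, φ ‖y‖ * ‖e - y‖ ^ (-((N : ℝ) + σ)) ≤
        (∫ y in {y | (0 < ‖y‖ ∧ ‖y‖ < 1) ∧ r < ‖e - y‖},
          (φ ‖y‖ + φ ‖y‖⁻¹ * ‖y‖ ^ (σ - N)) * ‖e - y‖ ^ (-((N : ℝ) + σ))) + C * r ^ (p - σ) := by
  have hne : Nonempty (Fin N) := ⟨⟨0, hN⟩⟩
  set ω := volume.real (Metric.closedBall (0 : EuclideanSpace ℝ (Fin N)) 1) with hω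
  refine ⟨B * 2 ^ N * 2 ^ (N + σ) * (N * ω), fun e he r hr hr2 => ?_⟩
  have hNσ : -((N : ℝ) + σ) ≤ 0 := by have : (0 : ℝ) ≤ N := N.cast_nonneg; linarith
  set F := fun y : EuclideanSpace ℝ (Fin N) => φ ‖y‖ * ‖e - y‖ ^ (-((N : ℝ) + σ)) with hF
  set H := fun y : EuclideanSpace ℝ (Fin N) =>
    φ ‖y‖⁻¹ * ‖y‖ ^ (σ - N) * ‖e - y‖ ^ (-((N : ℝ) + σ)) with hH
  have hFm : Measurable F := by fun_prop
  have hHm : Measurable H := by fun_prop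
  set P := {y : EuclideanSpace ℝ (Fin N) | (0 < ‖y‖ ∧ ‖y‖ < 1) ∧ r < ‖e - y‖} with hP
  set S := {y : EuclideanSpace ℝ (Fin N) | (0 < ‖y‖ ∧ ‖y‖ < 1) ∧ r * ‖y‖ < ‖e - y‖} with hS
  set O := {y : EuclideanSpace ℝ (Fin N) | 1 < ‖y‖ ∧ r < ‖e - y‖} with hO
  have hPm : MeasurableSet P := by measurability
  have hSm : MeasurableSet S := by measurability
  have hOm : MeasurableSet O := by measurability
  have hP1 : P ⊆ Metric.ball 0 1 := fun y hy => by simpa using hy.1.2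
  have hS1 : S ⊆ Metric.ball 0 1 := fun y hy => by simpa using hy.1.2
  have hPfin : volume P ≠ ⊤ := measure_ne_top_of_subset hP1 measure_ball_lt_top.ne
  have hFP : IntegrableOn F P := by
    refine Measure.integrableOn_of_bounded (M := B * r ^ (-((N : ℝ) + σ))) hPfin
      hFm.aestronglyMeasurable ?_
    refine (ae_restrict_iff' hPm).2 (Eventually.of_forall fun y hy => ?_)
    rw [hF, norm_mul, Real.norm_eq_abs, Real.norm_of_nonneg (by positivity)]
    exact mul_le_mul (hin _ hy.1.1 hy.1.2) (Real.rpow_le_rpow_of_nonpos hr hy.2.le hNσ)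
      (by positivity) hB
  have hdist : ∀ y : EuclideanSpace ℝ (Fin N), 1 - ‖y‖ ≤ ‖e - y‖ := fun y => by
    have := norm_sub_norm_le e y
    rwa [he] at this
  have hSdist : ∀ y ∈ S, r / 2 ≤ ‖e - y‖ := fun y hy => by
    rcases le_total (1 / 2) ‖y‖ with h | h
    · have h2 := hy.2
      nlinarith
    · have := hdist y
      linarith
  have hH0 : ∀ y ∈ S, 0 ≤ H y := fun y hy => by
    have := hout0 _ hy.1.1 hy.1.2
    simp only [hH]
    positivity
  have hHS : IntegrableOn H S := by
    have h1 : IntegrableOn (fun y : EuclideanSpace ℝ (Fin N) =>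
        B * ‖y‖ ^ (-θ) * (r / 2) ^ (-((N : ℝ) + σ))) S :=
      (((integrableOn_ball_norm_rpow hN (by linarith) one_pos).mono_set hS1).const_mul B).mul_const _
    refine h1.mono' hHm.aestronglyMeasurable ?_
    refine (ae_restrict_iff' hSm).2 (Eventually.of_forall fun y hy => ?_)
    rw [Real.norm_of_nonneg (hH0 y hy)]
    simp only [hH]
    exact mul_le_mul (hout _ hy.1.1 hy.1.2)
      (Real.rpow_le_rpow_of_nonpos (by linarith) (hSdist y hy) hNσ) (by positivity) (by positivity)
  have hS0 : ∀ y ∈ S, y ≠ 0 := fun y hy => norm_pos_iff.1 hy.1.1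
  have hcv : ∀ y ∈ S, (‖y‖⁻¹) ^ (2 * N) * F (EuclideanGeometry.inversion 0 1 y) = H y := by
    intro y hy
    simp only [hF, hH, norm_inversion_zero_one, norm_sub_inversion_zero_one he (hS0 y hy)]
    have hy0 := hy.1.1
    rw [Real.mul_rpow (by positivity) (by positivity), Real.inv_rpow hy0.le, Real.rpow_neg hy0.le,
      inv_inv, Real.rpow_sub hy0, Real.rpow_add hy0, Real.rpow_natCast, two_mul, pow_add, inv_pow]
    field_simp
  have hFO : IntegrableOn F O := by
    rw [hO, ← inversion_image_outer he r, integrableOn_inversion hSm hS0]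
    exact hHS.congr_fun (fun y hy => (hcv y hy).symm) hSm
  have hFOi : ∫ y in O, F y = ∫ y in S, H y := by
    rw [hO, ← inversion_image_outer he r, setIntegral_inversion hSm hS0]
    exact setIntegral_congr_fun hSm hcv
  have hPO : Disjoint P O := Set.disjoint_left.2 fun y hy hy' => absurd hy.1.2 (not_lt.2 hy'.1.le)
  have hae : ({y | r < ‖e - y‖} : Set (EuclideanSpace ℝ (Fin N))) =ᵐ[volume] (P ∪ O : Set _) := by
    have h1 : volume (Metric.sphere (0 : EuclideanSpace ℝ (Fin N)) 1) = 0 :=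
      Measure.addHaar_sphere volume 0 1
    have h2 : volume ({0} : Set (EuclideanSpace ℝ (Fin N))) = 0 := measure_singleton 0
    filter_upwards [compl_mem_ae_iff.2 h1, compl_mem_ae_iff.2 h2] with y hy1 hy2
    have hy1' : ‖y‖ ≠ 1 := by simpa using hy1
    have hy2' : 0 < ‖y‖ := by simpa using hy2
    refine propext ⟨fun (h : r < ‖e - y‖) => ?_, ?_⟩
    · rcases lt_or_gt_of_ne hy1' with h1 | h1
      · exact Or.inl ⟨⟨hy2', h1⟩, h⟩
      · exact Or.inr ⟨h1, h⟩
    · rintro (h | h)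
      · exact h.2
      · exact h.2
  have hPS : P ⊆ S := fun y hy => ⟨hy.1, lt_of_le_of_lt (mul_le_of_le_one_right hr.le hy.1.2.le) hy.2⟩
  have hHP : IntegrableOn H P := hHS.mono_set hPS
  have hG : ∀ y, (φ ‖y‖ + φ ‖y‖⁻¹ * ‖y‖ ^ (σ - N)) * ‖e - y‖ ^ (-((N : ℝ) + σ)) = F y + H y :=
    fun y => by simp only [hF, hH]; ring
  simp only [hG]
  refine ⟨(hFP.union hFO).congr_set_ae hae, hFP.add hHP, ?_⟩
  rw [setIntegral_congr_set hae, setIntegral_union hPO hOm hFP hFO, hFOi,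
    integral_add hFP hHP, add_assoc]
  have hsplit : ∫ y in S, H y = (∫ y in P, H y) + ∫ y in S \ P, H y := by
    rw [← setIntegral_union disjoint_sdiff_right (hSm.diff hPm) hHP (hHS.mono_set sdiff_subset),
      Set.union_sdiff_cancel hPS]
  rw [hsplit]
  have hD : S \ P ⊆ Metric.closedBall e r \ Metric.closedBall e (r * (1 - r)) := by
    intro y hy
    have h1 : ‖e - y‖ ≤ r := by
      by_contra h
      exact hy.2 ⟨hy.1.1, not_le.1 h⟩
    have h2 := hdist y
    have h3 := hy.1.2
    simp only [Set.mem_sdiff, Metric.mem_closedBall, dist_comm y e, dist_eq_norm, not_le]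
    refine ⟨h1, lt_of_le_of_lt ?_ h3⟩
    gcongr
    linarith
  have hDv : volume.real (S \ P) ≤ N * ω * r ^ (N + 1) :=
    (measureReal_mono hD (measure_ne_top_of_subset sdiff_subset measure_closedBall_lt_top.ne)).trans
      (volume_real_shell_le e hr (by linarith))
  have hbound : ∫ y in S \ P, H y ≤
      (B * r ^ (p - 1) * 2 ^ N * (r / 2) ^ (-((N : ℝ) + σ))) * volume.real (S \ P) := by
    have hfin : volume (S \ P) < ⊤ :=
      (measure_mono (sdiff_subset.trans hS1)).trans_lt measure_ball_lt_top
    refine (Real.le_norm_self _).trans (norm_setIntegral_le_of_norm_le_const hfin fun y hy => ?_)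
    rw [Real.norm_of_nonneg (hH0 y hy.1)]
    simp only [hH]
    have h1 : ‖e - y‖ ≤ r := by
      by_contra h
      exact hy.2 ⟨hy.1.1, not_le.1 h⟩
    have h2 := hdist y
    have h3 : 1 / 2 ≤ ‖y‖ := by linarith
    have h0 := hout0 _ hy.1.1.1 hy.1.1.2
    have h4 : ‖y‖ ^ (σ - N) ≤ 2 ^ N := by
      calc ‖y‖ ^ (σ - N) ≤ ‖y‖ ^ (-(N : ℝ)) :=
            Real.rpow_le_rpow_of_exponent_ge hy.1.1.1 hy.1.1.2.le (by linarith)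
        _ = (‖y‖⁻¹) ^ N := by rw [Real.rpow_neg (norm_nonneg _), Real.rpow_natCast, inv_pow]
        _ ≤ 2 ^ N := by
          gcongr
          rw [inv_le_comm₀ hy.1.1.1 two_pos]
          linarith
    have h5 : φ ‖y‖⁻¹ ≤ B * r ^ (p - 1) := by
      refine (hlip _ h3 hy.1.1.2).trans ?_
      have := hy.1.1.2
      gcongr
      linarith
    have h6 : ‖e - y‖ ^ (-((N : ℝ) + σ)) ≤ (r / 2) ^ (-((N : ℝ) + σ)) :=
      Real.rpow_le_rpow_of_nonpos (by linarith) (hSdist y hy.1) hNσ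
    exact mul_le_mul (mul_le_mul h5 h4 (by positivity) (by positivity)) h6 (by positivity)
      (by positivity)
  have hfin : (B * r ^ (p - 1) * 2 ^ N * (r / 2) ^ (-((N : ℝ) + σ))) * (N * ω * r ^ (N + 1)) =
      B * 2 ^ N * 2 ^ (N + σ) * (N * ω) * r ^ (p - σ) := by
    have e1 : r ^ (p - σ) = r ^ (p - 1) * r ^ (-((N : ℝ) + σ)) * r ^ (N + 1) := by
      rw [← Real.rpow_natCast, ← Real.rpow_add hr, ← Real.rpow_add hr]
      congr 1
      push_cast
      ring
    have e2 : (r / 2) ^ (-((N : ℝ) + σ)) = r ^ (-((N : ℝ) + σ)) * 2 ^ (N + σ) := by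
      rw [Real.div_rpow hr.le two_pos.le, Real.rpow_neg two_pos.le, div_inv_eq_mul]
    rw [e1, e2]
    ring
  have hlast := hbound.trans (mul_le_mul_of_nonneg_left hDv (by positivity))
  rw [hfin] at hlast
  linarith

lemma abs_rpow_mul_self_of_nonneg {p a : ℝ} (hp : 1 < p) (ha : 0 ≤ a) :
    |a| ^ (p - 2) * a = a ^ (p - 1) := by
  rcases ha.eq_or_lt with rfl | ha
  · rw [mul_zero, Real.zero_rpow (by linarith)]
  · rw [abs_of_pos ha, ← Real.rpow_add_one ha.ne']
    congr 1
    ring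

lemma abs_rpow_mul_self_of_nonpos {p a : ℝ} (hp : 1 < p) (ha : a ≤ 0) :
    |a| ^ (p - 2) * a = -(-a) ^ (p - 1) := by
  rw [← abs_rpow_mul_self_of_nonneg hp (neg_nonneg.2 ha), abs_neg]
  ring

lemma abs_rpow_mul_self_mono {p : ℝ} (hp : 1 < p) : Monotone fun a : ℝ => |a| ^ (p - 2) * a := by
  intro a b hab
  have hp' : 0 ≤ p - 1 := by linarith
  rcases le_total 0 a with ha | ha
  · simp only [abs_rpow_mul_self_of_nonneg hp ha, abs_rpow_mul_self_of_nonneg hp (ha.trans hab)]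
    gcongr
  · rcases le_total 0 b with hb | hb
    · exact (mul_nonpos_of_nonneg_of_nonpos (by positivity) ha).trans (by positivity)
    · simp only [abs_rpow_mul_self_of_nonpos hp ha, abs_rpow_mul_self_of_nonpos hp hb]
      have : 0 ≤ -b := by linarith
      gcongr

lemma abs_rpow_mul_self_const_mul {p c : ℝ} (hp : 1 < p) (hc : 0 ≤ c) (a : ℝ) :
    |c * a| ^ (p - 2) * (c * a) = c ^ (p - 1) * (|a| ^ (p - 2) * a) := by
  rw [abs_mul, Real.mul_rpow (abs_nonneg _) (abs_nonneg _), mul_mul_mul_comm,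
    abs_rpow_mul_self_of_nonneg hp hc]

lemma pvFracPLap.comp_affine {N : ℕ} {s p : ℝ} {u : EuclideanSpace ℝ (Fin N) → ℝ}
    {x₀ e : EuclideanSpace ℝ (Fin N)} {ρ L : ℝ} (hρ : 0 < ρ)
    (h : pvFracPLap N s p u (x₀ + ρ • e) L) :
    pvFracPLap N s p (fun z => u (x₀ + ρ • z)) e (ρ ^ (s * p) * L) := by
  set x := x₀ + ρ • e with hx
  have hnorm : ∀ z, ‖x - (x₀ + ρ • z)‖ = ρ * ‖e - z‖ := fun z => by
    rw [hx, add_sub_add_left_eq_sub, ← smul_sub, norm_smul, Real.norm_of_nonneg hρ.le]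
  set g := fun y => |u x - u y| ^ (p - 2) * (u x - u y) * ‖x - y‖ ^ (-((N : ℝ) + s * p)) with hg
  set f := fun z => |u x - u (x₀ + ρ • z)| ^ (p - 2) * (u x - u (x₀ + ρ • z)) *
    ‖e - z‖ ^ (-((N : ℝ) + s * p)) with hf
  have hmeas : ∀ r : ℝ, ∀ x : EuclideanSpace ℝ (Fin N), MeasurableSet {y | r < ‖x - y‖} :=
    fun r x => by measurability
  have hind : ∀ r : ℝ, {z | r < ‖e - z‖}.indicator f =
      fun z => ρ ^ (N + s * p) * {y | ρ * r < ‖x - y‖}.indicator g (x₀ + ρ • z) := by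
    intro r
    funext z
    have hiff : z ∈ {z | r < ‖e - z‖} ↔ x₀ + ρ • z ∈ {y | ρ * r < ‖x - y‖} := by
      simp only [mem_ofPred_eq, hnorm, mul_lt_mul_iff_right₀ hρ]
    by_cases hz : z ∈ {z | r < ‖e - z‖}
    · rw [indicator_of_mem hz, indicator_of_mem (hiff.1 hz)]
      simp only [hf, hg, hnorm]
      rw [Real.mul_rpow hρ.le (norm_nonneg _), Real.rpow_neg hρ.le]
      have : ρ ^ (N + s * p) ≠ 0 := (Real.rpow_pos_of_pos hρ _).ne'
      field_simp
    · rw [indicator_of_notMem hz, indicator_of_notMem (fun h => hz (hiff.2 h)), mul_zero]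
  have hscale : ∀ r : ℝ, ∫ z in {z | r < ‖e - z‖}, f z =
      ρ ^ (s * p) * ∫ y in {y | ρ * r < ‖x - y‖}, g y := by
    intro r
    rw [← integral_indicator (hmeas _ _), hind, integral_const_mul,
      Measure.integral_comp_smul volume
        (fun y => {y | ρ * r < ‖x - y‖}.indicator g (x₀ + y)) ρ,
      integral_add_left_eq_self, integral_indicator (hmeas _ _)]
    simp only [finrank_euclideanSpace, Fintype.card_fin, smul_eq_mul]
    rw [abs_of_pos (by positivity), Real.rpow_add hρ, Real.rpow_natCast]
    field_simp
  refine ⟨fun r hr => ?_, ?_⟩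
  · change IntegrableOn f _ _
    rw [← integrable_indicator_iff (hmeas _ _), hind]
    have h1 := (integrable_indicator_iff (hmeas _ _)).2 (h.1 (ρ * r) (by positivity))
    exact ((h1.comp_add_left x₀).comp_smul hρ.ne').const_mul _
  · change Tendsto (fun r => ∫ z in {z | r < ‖e - z‖}, f z) _ _
    simp_rw [hscale]
    refine (h.2.comp ?_).const_mul _
    refine tendsto_nhdsWithin_iff.2 ⟨?_, ?_⟩
    · have : Tendsto (fun r => ρ * r) (nhds 0) (nhds (ρ * 0)) := tendsto_id.const_mul ρ
      rw [mul_zero] at this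
      exact this.mono_left nhdsWithin_le_nhds
    · filter_upwards [self_mem_nhdsWithin] with r hr
      exact mul_pos hρ hr

lemma pvFracPLap.le_of_touching {N : ℕ} {s p : ℝ} {v : EuclideanSpace ℝ (Fin N) → ℝ}
    {e : EuclideanSpace ℝ (Fin N)} {L c M C : ℝ} {φ : ℝ → ℝ} (hsp : s * p < p)
    (h : pvFracPLap N s p v e L)
    (htouch : ∀ y, |v e - v y| ^ (p - 2) * (v e - v y) ≤ c * φ ‖y‖)
    (hφ : ∀ r : ℝ, 0 < r → r < 1 / 2 →
      IntegrableOn (fun y => φ ‖y‖ * ‖e - y‖ ^ (-((N : ℝ) + s * p))) {y | r < ‖e - y‖} ∧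
      ∫ y in {y | r < ‖e - y‖}, φ ‖y‖ * ‖e - y‖ ^ (-((N : ℝ) + s * p)) ≤
        M + C * r ^ (p - s * p)) (hc : 0 ≤ c) :
    L ≤ c * M := by
  have hlim : Tendsto (fun r : ℝ => c * (M + C * r ^ (p - s * p))) (nhdsWithin 0 (Ioi 0))
      (nhds (c * M)) := by
    have h1 : ContinuousAt (fun r : ℝ => c * (M + C * r ^ (p - s * p))) 0 := by
      have := Real.continuousAt_rpow_const 0 (p - s * p) (Or.inr (by linarith))
      fun_prop
    have h2 := h1.tendsto
    simp only [Real.zero_rpow (show p - s * p ≠ 0 by linarith), mul_zero, add_zero] at h2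
    exact h2.mono_left nhdsWithin_le_nhds
  refine le_of_tendsto_of_tendsto h.2 hlim ?_
  filter_upwards [Ioo_mem_nhdsGT (show (0 : ℝ) < 1 / 2 by norm_num)] with r hr
  obtain ⟨h1, h2⟩ := hφ r hr.1 hr.2
  refine le_trans ?_ (mul_le_mul_of_nonneg_left h2 hc)
  rw [← integral_const_mul]
  refine setIntegral_mono (h.1 r hr.1) (h1.const_mul c) fun y => ?_
  rw [← mul_assoc]
  exact mul_le_mul_of_nonneg_right (htouch y) (by positivity)

lemma one_sub_rpow_le {β ρ : ℝ} (hβ : 0 < β) (h0 : 0 < ρ) (h1 : ρ ≤ 1) :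
    1 - ρ ^ β ≤ (1 + β) * (1 - ρ) := by
  rcases le_total 1 β with h | h
  · have h2 := one_add_mul_self_le_rpow_one_add (s := ρ - 1) (by linarith) h
    rw [add_sub_cancel] at h2
    nlinarith
  · have h2 := Real.rpow_le_rpow_of_exponent_ge h0 h1 h
    rw [Real.rpow_one] at h2
    nlinarith

lemma norm_sub_rpow_neg_le {E : Type*} [NormedAddCommGroup E] {e y : E} (he : ‖e‖ = 1) {κ : ℝ}
    (hκ : 0 < κ) (hy : ‖y‖ ≤ 1 / 2) : ‖e - y‖ ^ (-κ) ≤ 2 ^ κ := by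
  have h1 : 1 / 2 ≤ ‖e - y‖ := by linarith [norm_sub_norm_le e y]
  refine (Real.rpow_le_rpow_of_nonpos (by norm_num) h1 (by linarith)).trans_eq ?_
  rw [one_div, Real.rpow_neg (by norm_num), Real.inv_rpow (by norm_num), inv_inv]

lemma le_norm_sub_rpow_neg {E : Type*} [NormedAddCommGroup E] {e y : E} (he : ‖e‖ = 1) {κ : ℝ}
    (hκ : 0 < κ) (hy : ‖y‖ < 1) : (2 : ℝ) ^ (-κ) ≤ ‖e - y‖ ^ (-κ) := by
  have h1 : ‖e - y‖ ≤ 2 := by linarith [norm_sub_le e y]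
  have h2 : 0 < ‖e - y‖ := by linarith [norm_sub_norm_le e y]
  exact Real.rpow_le_rpow_of_nonpos h2 h1 (by linarith)

section TruncatedPower

variable {p β δ ρ : ℝ}

lemma truncatedPower_of_lt (hp : 1 < p) (hβ : 0 < β) (h0 : 0 < ρ) (h1 : ρ < 1) (h : δ ≤ ρ) :
    |1 - (max ρ δ) ^ (-β)| ^ (p - 2) * (1 - (max ρ δ) ^ (-β)) =
      -(ρ ^ (-(β * (p - 1))) * (1 - ρ ^ β) ^ (p - 1)) := by
  have h2 : 1 ≤ ρ ^ (-β) := Real.one_le_rpow_of_pos_of_le_one_of_nonpos h0 h1.le (by linarith)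
  have h3 : 0 ≤ 1 - ρ ^ β := by linarith [Real.rpow_le_one h0.le h1.le hβ.le]
  rw [max_eq_left h, abs_rpow_mul_self_of_nonpos hp (by linarith), neg_sub, ← neg_mul β,
    Real.rpow_mul h0.le, ← Real.mul_rpow (by positivity) h3]
  congr 2
  rw [mul_sub, ← Real.rpow_add h0]
  simp

lemma truncatedPower_nonpos (hδ : 0 < δ) (hδ1 : δ < 1) (hβ : 0 < β) (h1 : ρ < 1) :
    |1 - (max ρ δ) ^ (-β)| ^ (p - 2) * (1 - (max ρ δ) ^ (-β)) ≤ 0 := by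
  have h2 : 1 ≤ (max ρ δ) ^ (-β) := Real.one_le_rpow_of_pos_of_le_one_of_nonpos
    (lt_max_of_lt_right hδ) (max_le h1.le hδ1.le) (by linarith)
  exact mul_nonpos_of_nonneg_of_nonpos (by positivity) (by linarith)

lemma truncatedPower_inv (hp : 1 < p) (hδ1 : δ < 1) (hβ : 0 < β) (h0 : 0 < ρ)
    (h1 : ρ < 1) :
    |1 - (max ρ⁻¹ δ) ^ (-β)| ^ (p - 2) * (1 - (max ρ⁻¹ δ) ^ (-β)) = (1 - ρ ^ β) ^ (p - 1) := by
  have h2 : δ ≤ ρ⁻¹ := hδ1.le.trans (one_le_inv_iff₀.2 ⟨h0, h1.le⟩)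
  have h3 : 0 ≤ 1 - ρ ^ β := by linarith [Real.rpow_le_one h0.le h1.le hβ.le]
  have h4 : ρ⁻¹ ^ (-β) = ρ ^ β := by
    rw [Real.rpow_neg (by positivity), Real.inv_rpow h0.le, inv_inv]
  rw [max_eq_left h2, h4, abs_rpow_mul_self_of_nonneg hp h3]

lemma abs_truncatedPower_le (hp : 1 < p) (hδ : 0 < δ) (hδ1 : δ < 1) (hβ : 0 < β) (h1 : ρ < 1) :
    |(|1 - (max ρ δ) ^ (-β)| ^ (p - 2) * (1 - (max ρ δ) ^ (-β)))| ≤ (δ ^ (-β)) ^ (p - 1) := by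
  have h2 : 1 ≤ (max ρ δ) ^ (-β) := Real.one_le_rpow_of_pos_of_le_one_of_nonpos
    (lt_max_of_lt_right hδ) (max_le h1.le hδ1.le) (by linarith)
  have h3 : (max ρ δ) ^ (-β) ≤ δ ^ (-β) :=
    Real.rpow_le_rpow_of_nonpos hδ (le_max_right _ _) (by linarith)
  have h4 : 0 ≤ (max ρ δ) ^ (-β) - 1 := by linarith
  rw [abs_rpow_mul_self_of_nonpos hp (by linarith), neg_sub, abs_neg,
    abs_of_nonneg (by positivity)]
  exact Real.rpow_le_rpow h4 (by linarith) (by linarith)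

lemma truncatedPower_bracket_le {σ n : ℝ} (hβ : 0 < β) (hβσ : n - σ < β * (p - 1))
    (h0 : 0 < ρ) (h1 : ρ < 1) :
    -(ρ ^ (-(β * (p - 1))) * (1 - ρ ^ β) ^ (p - 1)) + (1 - ρ ^ β) ^ (p - 1) * ρ ^ (σ - n) ≤ 0 := by
  have h3 : 0 ≤ 1 - ρ ^ β := by linarith [Real.rpow_le_one h0.le h1.le hβ.le]
  have h4 : ρ ^ (σ - n) ≤ ρ ^ (-(β * (p - 1))) :=
    Real.rpow_le_rpow_of_exponent_ge h0 h1.le (by linarith)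
  have h5 : 0 ≤ (1 - ρ ^ β) ^ (p - 1) := by positivity
  nlinarith

lemma truncatedPower_bracket_le_of_lt_half {σ n : ℝ} (hp : 1 < p) (hβ : 0 < β) (hσn : σ < n)
    (hβσ : n - σ < β * (p - 1)) (h0 : 0 < ρ) (h1 : ρ < 1 / 2) :
    -(ρ ^ (-(β * (p - 1))) * (1 - ρ ^ β) ^ (p - 1)) + (1 - ρ ^ β) ^ (p - 1) * ρ ^ (σ - n) ≤
      -((1 - (1 / 2) ^ β) ^ (p - 1) * ((1 / 2) ^ (-(β * (p - 1) - (n - σ))) - 1)) := by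
  set ν := β * (p - 1) - (n - σ) with hν
  have hν0 : 0 < ν := by linarith
  have hhalf : ((1 : ℝ) / 2) ^ β ≤ 1 := Real.rpow_le_one (by norm_num) (by norm_num) hβ.le
  have h3 : (1 - ((1 : ℝ) / 2) ^ β) ^ (p - 1) ≤ (1 - ρ ^ β) ^ (p - 1) :=
    Real.rpow_le_rpow (by linarith)
      (by linarith [Real.rpow_le_rpow h0.le h1.le hβ.le]) (by linarith)
  have h3' : 0 ≤ (1 - ((1 : ℝ) / 2) ^ β) ^ (p - 1) := Real.rpow_nonneg (by linarith) _
  have h4 : ((1 : ℝ) / 2) ^ (-ν) ≤ ρ ^ (-ν) :=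
    Real.rpow_le_rpow_of_nonpos h0 h1.le (by linarith)
  have h4' : 1 ≤ ((1 : ℝ) / 2) ^ (-ν) :=
    Real.one_le_rpow_of_pos_of_le_one_of_nonpos (by norm_num) (by norm_num) (by linarith)
  have h5 : 1 ≤ ρ ^ (σ - n) :=
    Real.one_le_rpow_of_pos_of_le_one_of_nonpos h0 (by linarith) (by linarith)
  have h6 : ρ ^ (-(β * (p - 1))) = ρ ^ (σ - n) * ρ ^ (-ν) := by
    rw [← Real.rpow_add h0]
    congr 1
    rw [hν]
    ring
  rw [h6]
  have h7 : ((1 : ℝ) / 2) ^ (-ν) - 1 ≤ ρ ^ (σ - n) * (ρ ^ (-ν) - 1) := by nlinarith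
  have h8 := mul_le_mul h3 h7 (by linarith) (h3'.trans h3)
  linarith

end TruncatedPower

lemma exists_truncatedPower_integral_le {N : ℕ} (hN : 1 ≤ N) {p σ β : ℝ} (hp : 1 < p) (hσ : 0 < σ)
    (hσN : σ < N) (hβ : 0 < β) (hβσ : N - σ < β * (p - 1)) :
    ∃ ε > 0, ε ≤ 1 / 4 ∧ ∀ δ > 0, δ ≤ ε → ∃ M < 0, ∃ C, ∀ e : EuclideanSpace ℝ (Fin N), ‖e‖ = 1 →
      ∀ r, 0 < r → r < 1 / 2 →
      IntegrableOn (fun y => |1 - (max ‖y‖ δ) ^ (-β)| ^ (p - 2) * (1 - (max ‖y‖ δ) ^ (-β)) *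
        ‖e - y‖ ^ (-((N : ℝ) + σ))) {y | r < ‖e - y‖} ∧
      ∫ y in {y | r < ‖e - y‖}, |1 - (max ‖y‖ δ) ^ (-β)| ^ (p - 2) * (1 - (max ‖y‖ δ) ^ (-β)) *
        ‖e - y‖ ^ (-((N : ℝ) + σ)) ≤ M + C * r ^ (p - σ) := by
  have hN0 : (0 : ℝ) < N := by exact_mod_cast hN
  set E := EuclideanSpace ℝ (Fin N)
  set ann : Set E := {y | 1 / 4 < ‖y‖ ∧ ‖y‖ < 1 / 2} with hann
  have hannO : IsOpen ann := by
    rw [hann, ofPred_and]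
    exact (isOpen_lt continuous_const continuous_norm).inter
      (isOpen_lt continuous_norm continuous_const)
  have hannm := hannO.measurableSet
  have hann_sub : ann ⊆ Metric.ball 0 1 := fun y hy => by
    rw [mem_ball_zero_iff]
    linarith [hy.2]
  have hV : 0 < volume.real ann := by
    have : Nontrivial E := by
      have : Nonempty (Fin N) := ⟨⟨0, hN⟩⟩
      infer_instance
    obtain ⟨x, hx⟩ := exists_norm_eq E (show (0 : ℝ) ≤ 3 / 8 by norm_num)
    have h1 := hannO.measure_pos volume ⟨x, by norm_num [hann, hx]⟩
    exact ENNReal.toReal_pos h1.ne' ((measure_mono hann_sub).trans_lt measure_ball_lt_top).ne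
  set V := volume.real ann
  set c₀ := ((1 - (1 / 2 : ℝ) ^ β) ^ (p - 1) * ((1 / 2) ^ (-(β * (p - 1) - (N - σ))) - 1)) *
    2 ^ (-((N : ℝ) + σ)) with hc₀
  have hhalf : ((1 : ℝ) / 2) ^ β < 1 := Real.rpow_lt_one (by norm_num) (by norm_num) hβ
  have hc₁ : 0 < (1 - (1 / 2 : ℝ) ^ β) ^ (p - 1) * ((1 / 2) ^ (-(β * (p - 1) - (N - σ))) - 1) := by
    refine mul_pos (Real.rpow_pos_of_pos (by linarith) _) ?_
    have := Real.one_lt_rpow_of_pos_of_lt_one_of_neg (x := 1 / 2)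
      (z := -(β * (p - 1) - (N - σ))) (by norm_num) (by norm_num) (by linarith)
    linarith
  have hc₀0 : 0 < c₀ := by positivity
  set I := ∫ y in Metric.ball (0 : E) 1, ‖y‖ ^ (σ - N) with hI
  have hlim : Tendsto (fun ε : ℝ => 2 ^ ((N : ℝ) + σ) * (ε ^ (σ - N + N) * I))
      (nhdsWithin 0 (Ioi 0)) (nhds 0) := by
    have h1 : ContinuousAt (fun ε : ℝ => 2 ^ ((N : ℝ) + σ) * (ε ^ (σ - N + N) * I)) 0 := by
      have := Real.continuousAt_rpow_const 0 (σ - N + N) (Or.inr (by linarith))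
      fun_prop
    have h2 := h1.tendsto
    simp only [Real.zero_rpow (show σ - N + N ≠ 0 by linarith), mul_zero, zero_mul] at h2
    exact h2.mono_left nhdsWithin_le_nhds
  obtain ⟨ε, hε1, hε2⟩ := ((hlim.eventually_lt_const (mul_pos hc₀0 hV)).and
    (Ioc_mem_nhdsGT (show (0 : ℝ) < 1 / 4 by norm_num))).exists
  have hI0 : 0 ≤ I := integral_nonneg fun y => by positivity
  refine ⟨ε, hε2.1, hε2.2, fun δ hδ hδε => ?_⟩
  have hδ1 : δ < 1 := by linarith [hε2.2]
  set φ : ℝ → ℝ := fun ρ => |1 - (max ρ δ) ^ (-β)| ^ (p - 2) * (1 - (max ρ δ) ^ (-β)) with hφ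
  have hφinv : ∀ ρ, 0 < ρ → ρ < 1 → φ ρ⁻¹ = (1 - ρ ^ β) ^ (p - 1) := fun ρ h0 h1 =>
    truncatedPower_inv hp hδ1 hβ h0 h1
  have hbase : ∀ ρ : ℝ, 0 < ρ → ρ < 1 → 0 ≤ 1 - ρ ^ β := fun ρ h0 h1 => by
    linarith [Real.rpow_le_one h0.le h1.le hβ.le]
  have hφinv1 : ∀ ρ, 0 < ρ → ρ < 1 → φ ρ⁻¹ ≤ 1 := fun ρ h0 h1 => by
    rw [hφinv ρ h0 h1]
    exact Real.rpow_le_one (hbase ρ h0 h1) (by linarith [Real.rpow_nonneg h0.le β]) (by linarith)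
  set B := 1 + (δ ^ (-β)) ^ (p - 1) + (1 + β) ^ (p - 1) with hB
  have hB1 : 0 < (δ ^ (-β)) ^ (p - 1) := by positivity
  have hB2 : 0 < (1 + β) ^ (p - 1) := by positivity
  obtain ⟨C, hC⟩ := radial_pv_reduction hN (p := p) (σ := σ) (θ := N - σ) (B := B) (φ := φ) hp hσ
    (by linarith) (by positivity) (by fun_prop)
    (fun ρ h0 h1 => (abs_truncatedPower_le hp hδ hδ1 hβ h1).trans (by linarith))
    (fun ρ h0 h1 => by
      rw [hφinv ρ h0 h1]
      exact Real.rpow_nonneg (hbase ρ h0 h1) _)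
    (fun ρ h0 h1 => by
      rw [neg_sub]
      exact mul_le_mul_of_nonneg_right ((hφinv1 ρ h0 h1).trans (by linarith)) (by positivity))
    (fun ρ h0 h1 => by
      have h0' : 0 < ρ := by linarith
      have h1' : 0 ≤ 1 - ρ := by linarith
      rw [hφinv ρ h0' h1]
      refine (Real.rpow_le_rpow (hbase ρ h0' h1) (one_sub_rpow_le hβ h0' h1.le)
        (by linarith)).trans ?_
      rw [Real.mul_rpow (by linarith) h1']
      exact mul_le_mul_of_nonneg_right (by linarith) (by positivity))
  refine ⟨2 ^ ((N : ℝ) + σ) * (ε ^ (σ - N + N) * I) - c₀ * V, by linarith, C,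
    fun e he r hr0 hr1 => ?_⟩
  obtain ⟨h1, h2, h3⟩ := hC e he r hr0 hr1
  refine ⟨h1, h3.trans (add_le_add_left ?_ _)⟩
  set S : Set E := {y | (0 < ‖y‖ ∧ ‖y‖ < 1) ∧ r < ‖e - y‖} with hS
  have hSm : MeasurableSet S := by measurability
  have hannS : ann ⊆ S := fun y hy =>
    ⟨⟨by linarith [hy.1], by linarith [hy.2]⟩, by linarith [norm_sub_norm_le e y, hy.2]⟩
  have hbInt : IntegrableOn (fun y : E => ‖y‖ ^ (σ - N)) (Metric.ball 0 δ) :=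
    integrableOn_ball_norm_rpow hN (by linarith) hδ
  have hbm : MeasurableSet (Metric.ball (0 : E) δ) := measurableSet_ball
  have hgint1 : Integrable ((Metric.ball (0 : E) δ).indicator fun y => ‖y‖ ^ (σ - N)) :=
    hbInt.integrable_indicator hbm
  have hgint2 : Integrable (ann.indicator fun _ : E => (1 : ℝ)) :=
    (integrableOn_const
      ((measure_mono hann_sub).trans_lt measure_ball_lt_top).ne).integrable_indicator hannm
  calc _ ≤ ∫ y in S, (2 ^ ((N : ℝ) + σ) * (Metric.ball (0 : E) δ).indicator
          (fun y => ‖y‖ ^ (σ - N)) y - c₀ * ann.indicator (fun _ => 1) y) := by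
        refine setIntegral_mono_on h2
          ((hgint1.const_mul _).sub (hgint2.const_mul _)).integrableOn hSm fun y hy => ?_
        obtain ⟨⟨hy0, hy1⟩, hyr⟩ := hy
        have hK : 0 ≤ ‖e - y‖ ^ (-((N : ℝ) + σ)) := by positivity
        rcases lt_or_ge ‖y‖ δ with hyδ | hyδ
        · rw [indicator_of_mem (mem_ball_zero_iff.2 hyδ),
            indicator_of_notMem fun h : y ∈ ann => by linarith [h.1, hε2.2], mul_zero, sub_zero]
          have hle : φ ‖y‖ + φ ‖y‖⁻¹ * ‖y‖ ^ (σ - N) ≤ ‖y‖ ^ (σ - N) := by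
            have := truncatedPower_nonpos (p := p) hδ hδ1 hβ hy1
            have h5 := mul_le_mul_of_nonneg_right (hφinv1 _ hy0 hy1)
              (Real.rpow_nonneg hy0.le (σ - N))
            change φ ‖y‖ ≤ 0 at this
            linarith
          rw [mul_comm ((2 : ℝ) ^ _)]
          refine (mul_le_mul_of_nonneg_right hle hK).trans (mul_le_mul_of_nonneg_left
            (norm_sub_rpow_neg_le he (by linarith) (by linarith [hε2.2])) (by positivity))
        · rw [indicator_of_notMem fun h => not_lt.2 hyδ (mem_ball_zero_iff.1 h), mul_zero, zero_sub,
            hφinv _ hy0 hy1]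
          have hφy : φ ‖y‖ = _ := truncatedPower_of_lt hp hβ hy0 hy1 hyδ
          rw [hφy]
          by_cases hya : y ∈ ann
          · rw [indicator_of_mem hya, mul_one, hc₀]
            have h6 := truncatedPower_bracket_le_of_lt_half hp hβ hσN hβσ hy0 hya.2
            have h7 := le_norm_sub_rpow_neg he (show 0 < (N : ℝ) + σ by linarith) hy1
            refine (mul_le_mul_of_nonneg_right h6 hK).trans ?_
            rw [neg_mul]
            exact neg_le_neg (mul_le_mul_of_nonneg_left h7 hc₁.le)
          · rw [indicator_of_notMem hya, mul_zero, neg_zero]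
            exact mul_nonpos_of_nonpos_of_nonneg
              (truncatedPower_bracket_le hβ hβσ hy0 hy1) hK
    _ = 2 ^ ((N : ℝ) + σ) * (∫ y in S, (Metric.ball (0 : E) δ).indicator
          (fun y => ‖y‖ ^ (σ - N)) y) - c₀ * V := by
        rw [integral_sub (hgint1.const_mul _).integrableOn (hgint2.const_mul _).integrableOn,
          integral_const_mul, integral_const_mul, setIntegral_indicator hannm,
          inter_eq_self_of_subset_right hannS, setIntegral_const, smul_eq_mul, mul_one]
    _ ≤ 2 ^ ((N : ℝ) + σ) * (ε ^ (σ - N + N) * I) - c₀ * V := by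
        gcongr 2 ^ ((N : ℝ) + σ) * ?_ - c₀ * V
        rw [setIntegral_indicator hbm]
        calc _ ≤ ∫ y in Metric.ball (0 : E) δ, ‖y‖ ^ (σ - N) :=
              setIntegral_mono_set hbInt (ae_of_all _ fun y => by positivity)
                (ae_of_all _ inter_subset_right)
          _ = δ ^ (σ - N + N) * I := integral_ball_norm_rpow hδ
          _ ≤ _ := mul_le_mul_of_nonneg_right (Real.rpow_le_rpow hδ.le hδε (by linarith)) hI0

lemma growingPower_of_lt {p γ ρ : ℝ} (hp : 1 < p) (hγ : 0 < γ) (h0 : 0 < ρ) (h1 : ρ < 1) :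
    |ρ ^ γ - 1| ^ (p - 2) * (ρ ^ γ - 1) = -(1 - ρ ^ γ) ^ (p - 1) := by
  rw [abs_rpow_mul_self_of_nonpos hp (by linarith [Real.rpow_le_one h0.le h1.le hγ.le]), neg_sub]

lemma growingPower_inv {p γ ρ : ℝ} (hp : 1 < p) (hγ : 0 < γ) (h0 : 0 < ρ) (h1 : ρ < 1) :
    |ρ⁻¹ ^ γ - 1| ^ (p - 2) * (ρ⁻¹ ^ γ - 1) = (ρ ^ (-γ) - 1) ^ (p - 1) := by
  rw [Real.inv_rpow h0.le, ← Real.rpow_neg h0.le, abs_rpow_mul_self_of_nonneg hp]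
  linarith [Real.one_le_rpow_of_pos_of_le_one_of_nonpos h0 h1.le (z := -γ) (by linarith)]

lemma growingPower_bracket {p γ ρ a : ℝ} (hγ : 0 < γ) (h0 : 0 < ρ) (h1 : ρ < 1) :
    -(1 - ρ ^ γ) ^ (p - 1) + (ρ ^ (-γ) - 1) ^ (p - 1) * ρ ^ a =
      (1 - ρ ^ γ) ^ (p - 1) * (ρ ^ (-(γ * (p - 1) - a)) - 1) := by
  have h3 : 0 ≤ 1 - ρ ^ γ := by linarith [Real.rpow_le_one h0.le h1.le hγ.le]
  have h4 : ρ ^ (-γ) - 1 = ρ ^ (-γ) * (1 - ρ ^ γ) := by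
    rw [mul_sub, ← Real.rpow_add h0]
    simp
  rw [h4, Real.mul_rpow (by positivity) h3, ← Real.rpow_mul h0.le,
    show -(γ * (p - 1) - a) = -γ * (p - 1) + a by ring, Real.rpow_add h0]
  ring

lemma growingPower_bracket_le {p γ θ ρ d κ : ℝ} (hp : 1 < p) (hγ : 0 < γ) (hγ1 : γ ≤ 1) (hθ : 0 < θ)
    (h0 : 1 / 2 ≤ ρ) (h1 : ρ < 1) (hd : 1 - ρ ≤ d) :
    (1 - ρ ^ γ) ^ (p - 1) * (ρ ^ (-θ) - 1) * d ^ κ ≤ 2 ^ θ * (1 + θ) * d ^ (p + κ) := by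
  have h0' : 0 < ρ := by linarith
  have hd0 : 0 < d := by linarith
  have h3 : 0 ≤ 1 - ρ ^ γ := by linarith [Real.rpow_le_one h0'.le h1.le hγ.le]
  have h4 : 1 - ρ ^ γ ≤ d := by
    have := Real.rpow_le_rpow_of_exponent_ge h0' h1.le hγ1
    rw [Real.rpow_one] at this
    linarith
  have h5 : ρ ^ (-θ) - 1 = ρ ^ (-θ) * (1 - ρ ^ θ) := by
    rw [mul_sub, ← Real.rpow_add h0']
    simp
  have h6 : 0 ≤ 1 - ρ ^ θ := by linarith [Real.rpow_le_one h0'.le h1.le hθ.le]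
  have h7 : ρ ^ (-θ) ≤ 2 ^ θ := by
    refine (Real.rpow_le_rpow_of_nonpos (by norm_num) h0 (by linarith)).trans_eq ?_
    rw [one_div, Real.rpow_neg (by norm_num), Real.inv_rpow (by norm_num), inv_inv]
  have h8 : 1 - ρ ^ θ ≤ (1 + θ) * d :=
    (one_sub_rpow_le hθ h0' h1.le).trans (mul_le_mul_of_nonneg_left hd (by linarith))
  have h9 : ρ ^ (-θ) - 1 ≤ 2 ^ θ * ((1 + θ) * d) := by
    rw [h5]
    exact mul_le_mul h7 h8 h6 (by positivity)
  have h10 : (1 - ρ ^ γ) ^ (p - 1) ≤ d ^ (p - 1) := Real.rpow_le_rpow h3 h4 (by linarith)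
  have h11 : 0 ≤ ρ ^ (-θ) - 1 := by
    rw [h5]
    positivity
  calc _ ≤ d ^ (p - 1) * (2 ^ θ * ((1 + θ) * d)) * d ^ κ :=
        mul_le_mul_of_nonneg_right (mul_le_mul h10 h9 h11 (by positivity)) (by positivity)
    _ = 2 ^ θ * (1 + θ) * (d ^ (p - 1) * d ^ (1 : ℝ) * d ^ κ) := by
        rw [Real.rpow_one]
        ring
    _ = _ := by
        rw [← Real.rpow_add hd0, ← Real.rpow_add hd0]
        ring_nf

lemma exists_growingPower_integral_le {N : ℕ} (hN : 1 ≤ N) {p σ γ : ℝ} (hp : 1 < p) (hσ : 0 < σ)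
    (hσN : σ < N) (hσp : σ < p) (hγ : 0 < γ) (hγ1 : γ ≤ 1) (hγσ : γ * (p - 1) < σ) :
    ∃ M ≥ 0, ∃ C, ∀ e : EuclideanSpace ℝ (Fin N), ‖e‖ = 1 → ∀ r, 0 < r → r < 1 / 2 →
      IntegrableOn (fun y => |‖y‖ ^ γ - 1| ^ (p - 2) * (‖y‖ ^ γ - 1) *
        ‖e - y‖ ^ (-((N : ℝ) + σ))) {y | r < ‖e - y‖} ∧
      ∫ y in {y | r < ‖e - y‖}, |‖y‖ ^ γ - 1| ^ (p - 2) * (‖y‖ ^ γ - 1) *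
        ‖e - y‖ ^ (-((N : ℝ) + σ)) ≤ M + C * r ^ (p - σ) := by
  have hN0 : (0 : ℝ) < N := by exact_mod_cast hN
  set E := EuclideanSpace ℝ (Fin N)
  set φ : ℝ → ℝ := fun ρ => |ρ ^ γ - 1| ^ (p - 2) * (ρ ^ γ - 1) with hφ
  set θ := γ * (p - 1) - (σ - N) with hθ
  have hγp : 0 < γ * (p - 1) := mul_pos hγ (by linarith)
  have hθ0 : 0 < θ := by linarith
  have hφinv : ∀ ρ, 0 < ρ → ρ < 1 → φ ρ⁻¹ = (ρ ^ (-γ) - 1) ^ (p - 1) := fun ρ h0 h1 =>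
    growingPower_inv hp hγ h0 h1
  have hφin : ∀ ρ, 0 < ρ → ρ < 1 → φ ρ = -(1 - ρ ^ γ) ^ (p - 1) := fun ρ h0 h1 =>
    growingPower_of_lt hp hγ h0 h1
  have hbase : ∀ ρ : ℝ, 0 < ρ → ρ < 1 → 0 ≤ 1 - ρ ^ γ := fun ρ h0 h1 => by
    linarith [Real.rpow_le_one h0.le h1.le hγ.le]
  have hbase1 : ∀ ρ : ℝ, 0 < ρ → ρ < 1 → (1 - ρ ^ γ) ^ (p - 1) ≤ 1 := fun ρ h0 h1 =>
    Real.rpow_le_one (hbase ρ h0 h1) (by linarith [Real.rpow_nonneg h0.le γ]) (by linarith)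
  have hbase' : ∀ ρ : ℝ, 0 < ρ → ρ < 1 → 0 ≤ ρ ^ (-γ) - 1 := fun ρ h0 h1 => by
    linarith [Real.one_le_rpow_of_pos_of_le_one_of_nonpos h0 h1.le (z := -γ) (by linarith)]
  have hB : (1 : ℝ) ≤ 2 ^ (p - 1) := Real.one_le_rpow (by norm_num) (by linarith)
  obtain ⟨C, hC⟩ := radial_pv_reduction hN (p := p) (σ := σ) (θ := θ) (B := 2 ^ (p - 1)) (φ := φ)
    hp hσ (by linarith) (by positivity) (by fun_prop)
    (fun ρ h0 h1 => by
      rw [hφin ρ h0 h1, abs_neg, abs_of_nonneg (Real.rpow_nonneg (hbase ρ h0 h1) _)]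
      exact (hbase1 ρ h0 h1).trans hB)
    (fun ρ h0 h1 => by
      rw [hφinv ρ h0 h1]
      exact Real.rpow_nonneg (hbase' ρ h0 h1) _)
    (fun ρ h0 h1 => by
      rw [hφinv ρ h0 h1, hθ, show -(γ * (p - 1) - (σ - N)) = -γ * (p - 1) + (σ - N) by ring,
        Real.rpow_add h0, ← mul_assoc, Real.rpow_mul h0.le]
      refine mul_le_mul_of_nonneg_right ?_ (by positivity)
      exact (Real.rpow_le_rpow (hbase' ρ h0 h1) (by linarith) (by linarith)).trans
        (le_mul_of_one_le_left (by positivity) hB))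
    (fun ρ h0 h1 => by
      have h0' : 0 < ρ := by linarith
      have h1' : 0 ≤ 1 - ρ := by linarith
      rw [hφinv ρ h0' h1, ← Real.mul_rpow (by norm_num) h1']
      refine Real.rpow_le_rpow (hbase' ρ h0' h1) ?_ (by linarith)
      have h2 := Real.rpow_le_rpow_of_exponent_ge h0' h1.le (show -1 ≤ -γ by linarith)
      rw [Real.rpow_neg_one] at h2
      have h3 : ρ⁻¹ * ρ = 1 := inv_mul_cancel₀ h0'.ne'
      have h4 : ρ⁻¹ ≤ 2 := by
        rw [inv_le_comm₀ h0' (by norm_num)]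
        linarith
      nlinarith)
  set h₁ : E → ℝ := (Metric.ball (0 : E) 1).indicator fun y => ‖y‖ ^ (-θ) with hh₁
  set h₂ : E → ℝ := (Metric.ball (0 : E) 2).indicator fun y => ‖y‖ ^ (p + -(N + σ)) with hh₂
  have hi₁ : Integrable h₁ :=
    (integrableOn_ball_norm_rpow hN (by linarith) one_pos).integrable_indicator measurableSet_ball
  have hi₂ : Integrable h₂ :=
    (integrableOn_ball_norm_rpow hN (by linarith) two_pos).integrable_indicator measurableSet_ball
  have hh₁0 : ∀ y, 0 ≤ h₁ y := fun y => indicator_nonneg (fun y _ => by positivity) y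
  have hh₂0 : ∀ y, 0 ≤ h₂ y := fun y => indicator_nonneg (fun y _ => by positivity) y
  set D := 2 ^ θ * (1 + θ) with hD
  have hD0 : 0 ≤ D := by positivity
  have hA0 : (0 : ℝ) ≤ 2 ^ ((N : ℝ) + σ) := by positivity
  refine ⟨2 ^ ((N : ℝ) + σ) * (∫ y, h₁ y) + D * ∫ y, h₂ y, ?_, C, fun e he r hr0 hr1 => ?_⟩
  · exact add_nonneg (mul_nonneg hA0 (integral_nonneg hh₁0)) (mul_nonneg hD0 (integral_nonneg hh₂0))
  obtain ⟨h1, h2, h3⟩ := hC e he r hr0 hr1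
  refine ⟨h1, h3.trans (add_le_add_left ?_ _)⟩
  set S : Set E := {y | (0 < ‖y‖ ∧ ‖y‖ < 1) ∧ r < ‖e - y‖} with hS
  have hSm : MeasurableSet S := by measurability
  have hi₂' : Integrable fun y => h₂ (e - y) := hi₂.comp_sub_left e
  have hg : Integrable fun y => 2 ^ ((N : ℝ) + σ) * h₁ y + D * h₂ (e - y) :=
    (hi₁.const_mul _).add (hi₂'.const_mul _)
  calc _ ≤ ∫ y in S, (2 ^ ((N : ℝ) + σ) * h₁ y + D * h₂ (e - y)) := by
        refine setIntegral_mono_on h2 hg.integrableOn hSm fun y hy => ?_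
        obtain ⟨⟨hy0, hy1⟩, hyr⟩ := hy
        have hb : φ ‖y‖ + φ ‖y‖⁻¹ * ‖y‖ ^ (σ - N) =
            (1 - ‖y‖ ^ γ) ^ (p - 1) * (‖y‖ ^ (-θ) - 1) := by
          rw [hφin _ hy0 hy1, hφinv _ hy0 hy1, growingPower_bracket hγ hy0 hy1]
        rw [hb]
        rcases lt_or_ge ‖y‖ (1 / 2) with hy2 | hy2
        · refine le_trans ?_ (le_add_of_nonneg_right (mul_nonneg hD0 (hh₂0 _)))
          rw [hh₁, indicator_of_mem (mem_ball_zero_iff.2 hy1), mul_comm ((2 : ℝ) ^ _)]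
          refine mul_le_mul ?_ (norm_sub_rpow_neg_le he (by linarith) hy2.le) (by positivity)
            (by positivity)
          have h4 : 0 ≤ (1 - ‖y‖ ^ γ) ^ (p - 1) := Real.rpow_nonneg (hbase _ hy0 hy1) _
          have h5 := hbase1 _ hy0 hy1
          have h6 : 0 ≤ ‖y‖ ^ (-θ) := by positivity
          nlinarith
        · refine le_trans ?_ (le_add_of_nonneg_left (mul_nonneg hA0 (hh₁0 _)))
          rw [hh₂, indicator_of_mem (mem_ball_zero_iff.2 (by linarith [norm_sub_le e y]))]
          exact growingPower_bracket_le hp hγ hγ1 hθ0 hy2 hy1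
            (by linarith [norm_sub_norm_le e y])
    _ ≤ ∫ y, (2 ^ ((N : ℝ) + σ) * h₁ y + D * h₂ (e - y)) :=
        setIntegral_le_integral hg (ae_of_all _ fun y =>
          add_nonneg (mul_nonneg hA0 (hh₁0 _)) (mul_nonneg hD0 (hh₂0 _)))
    _ = _ := by
        rw [integral_add (hi₁.const_mul _) (hi₂'.const_mul _), integral_const_mul,
          integral_const_mul, integral_sub_left_eq_self h₂]

lemma exists_power_lower_bound {N : ℕ} (hN : 1 ≤ N) {s p β : ℝ} (hp : 1 < p) (hs : 0 < s)
    (hs1 : s < 1) (hsN : s * p < N) (hβ : 0 < β) (hβσ : N - s * p < β * (p - 1)) :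
    ∃ κ > 0, ∀ u : EuclideanSpace ℝ (Fin N) → ℝ, Continuous u → (∀ x, 0 ≤ u x) →
      (∀ x, ∃ L ≥ 0, pvFracPLap N s p u x L) → ∀ R > 0, ∀ a, (∀ x, ‖x‖ ≤ R → a ≤ u x) →
      ∀ x, R ≤ ‖x‖ → κ * a * (‖x‖ / R) ^ (-β) ≤ u x := by
  have hσ : 0 < s * p := by positivity
  have hσp : s * p < p := by nlinarith
  obtain ⟨ε, hε0, hε1, hε⟩ := exists_truncatedPower_integral_le hN hp hσ hsN hβ hβσ
  refine ⟨ε ^ β, by positivity, fun u hu hu0 hL R hR a ha x₁ hx₁ => ?_⟩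
  by_contra! hlt
  have ha0 : 0 < a := by
    have h1 : 0 < ε ^ β * a * (‖x₁‖ / R) ^ (-β) := (hu0 x₁).trans_lt hlt
    exact pos_of_mul_pos_right (pos_of_mul_pos_left h1 (by positivity)) (by positivity)
  set A := ε ^ β * a with hA
  have hA0 : 0 < A := by positivity
  set w : EuclideanSpace ℝ (Fin N) → ℝ := fun x => A * (max (‖x‖ / R) ε) ^ (-β) with hw
  have hmax : ∀ x : EuclideanSpace ℝ (Fin N), 0 < max (‖x‖ / R) ε := fun x =>
    lt_max_of_lt_right hε0
  have hwc : Continuous w := by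
    refine continuous_const.mul (Continuous.rpow_const (by fun_prop) fun x => Or.inl (hmax x).ne')
  have hwa : ∀ x, w x ≤ a := fun x => by
    have h1 : (max (‖x‖ / R) ε) ^ (-β) ≤ ε ^ (-β) :=
      Real.rpow_le_rpow_of_nonpos hε0 (le_max_right _ _) (by linarith)
    refine (mul_le_mul_of_nonneg_left h1 hA0.le).trans_eq ?_
    rw [hA, mul_right_comm, ← Real.rpow_add hε0]
    simp
  have hw₁ : u x₁ < w x₁ := by
    have h1 : ε ≤ ‖x₁‖ / R := by
      rw [le_div_iff₀ hR]
      nlinarith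
    simpa only [hw, max_eq_left h1] using hlt
  have hlim : Tendsto w (cocompact _) (nhds 0) := by
    have h1 : Tendsto (fun x : EuclideanSpace ℝ (Fin N) => max (‖x‖ / R) ε) (cocompact _) atTop :=
      tendsto_atTop_mono (fun x => le_max_left _ _)
        (tendsto_norm_cocompact_atTop.atTop_div_const hR)
    simpa using ((tendsto_rpow_neg_atTop hβ).comp h1).const_mul A
  obtain ⟨x₀, hx₀⟩ := (hu.sub hwc).exists_forall_le' x₁ (by
    filter_upwards [hlim.eventually_lt_const (sub_pos.2 hw₁)] with x hx
    have := hu0 x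
    simp only [Pi.sub_apply]
    linarith)
  simp only [Pi.sub_apply] at hx₀
  have hR₀ : R < ‖x₀‖ := by
    by_contra! h
    linarith [hx₀ x₁, ha x₀ h, hwa x₀]
  set r₀ := ‖x₀‖ with hr₀
  have hr₀0 : 0 < r₀ := hR.trans hR₀
  obtain ⟨L, hL0, hL⟩ := hL x₀
  set e := r₀⁻¹ • x₀ with he
  have he1 : ‖e‖ = 1 := by
    rw [he, norm_smul, norm_inv, hr₀, norm_norm, inv_mul_cancel₀ hr₀0.ne']
  have hre : r₀ • e = x₀ := by rw [he, smul_inv_smul₀ hr₀0.ne']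
  have hv : pvFracPLap N s p (fun z => u (0 + r₀ • z)) e (r₀ ^ (s * p) * L) :=
    pvFracPLap.comp_affine hr₀0 (by rwa [zero_add, hre])
  set δ := ε * R / r₀ with hδ
  have hδ0 : 0 < δ := by positivity
  have hδε : δ ≤ ε := by
    rw [hδ, div_le_iff₀ hr₀0]
    nlinarith
  obtain ⟨M, hM, C, hC⟩ := hε δ hδ0 hδε
  set c := A * (r₀ / R) ^ (-β) with hc
  have hc0 : 0 < c := by positivity
  have hwz : ∀ z, w (r₀ • z) = c * (max ‖z‖ δ) ^ (-β) := fun z => by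
    have h1 : max (‖r₀ • z‖ / R) ε = r₀ / R * max ‖z‖ δ := by
      rw [mul_max_of_nonneg _ _ (by positivity), norm_smul, Real.norm_of_nonneg hr₀0.le]
      congr 1
      · ring
      · rw [hδ]
        field_simp
    simp only [hw, h1, hc]
    rw [Real.mul_rpow (by positivity) (le_max_of_le_left (norm_nonneg _)), ← mul_assoc]
  have hle := hv.le_of_touching (c := c ^ (p - 1))
    (φ := fun ρ => |1 - (max ρ δ) ^ (-β)| ^ (p - 2) * (1 - (max ρ δ) ^ (-β))) hσp (fun y => by
      rw [← abs_rpow_mul_self_const_mul hp hc0.le]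
      refine abs_rpow_mul_self_mono hp ?_
      have h1 := hx₀ (r₀ • y)
      have h2 := hwz e
      rw [hre, he1, max_eq_left (by linarith), Real.one_rpow, mul_one] at h2
      rw [hwz, h2] at h1
      simp only [zero_add, hre]
      linarith) (hC e he1) (by positivity)
  have h1 : c ^ (p - 1) * M < 0 := mul_neg_of_pos_of_neg (by positivity) hM
  have h2 : 0 ≤ r₀ ^ (s * p) * L := by positivity
  linarith

lemma exists_growing_upper_bound {N : ℕ} (hN : 1 ≤ N) {s p γ : ℝ} (hp : 1 < p) (hs : 0 < s)
    (hs1 : s < 1) (hsN : s * p < N) (hγ : 0 < γ) (hγ1 : γ ≤ 1) (hγσ : γ * (p - 1) < s * p) :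
    ∃ M ≥ 0, ∀ (u : EuclideanSpace ℝ (Fin N) → ℝ) (D : ℝ) (x₀ : EuclideanSpace ℝ (Fin N)) (L : ℝ),
      0 < D → x₀ ≠ 0 → (∀ x, u x₀ + D * ‖x₀‖ ^ γ ≤ u x + D * ‖x‖ ^ γ) →
      pvFracPLap N s p u x₀ L → ‖x₀‖ ^ (s * p) * L ≤ (D * ‖x₀‖ ^ γ) ^ (p - 1) * M := by
  have hσ : 0 < s * p := by positivity
  have hσp : s * p < p := by nlinarith
  obtain ⟨M, hM, C, hC⟩ := exists_growingPower_integral_le hN hp hσ hsN hσp hγ hγ1 hγσ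
  refine ⟨M, hM, fun u D x₀ L hD hx₀ hmin hL => ?_⟩
  set r₀ := ‖x₀‖ with hr₀
  have hr₀0 : 0 < r₀ := norm_pos_iff.2 hx₀
  set e := r₀⁻¹ • x₀ with he
  have he1 : ‖e‖ = 1 := by
    rw [he, norm_smul, norm_inv, hr₀, norm_norm, inv_mul_cancel₀ hr₀0.ne']
  have hre : r₀ • e = x₀ := by rw [he, smul_inv_smul₀ hr₀0.ne']
  have hv : pvFracPLap N s p (fun z => u (0 + r₀ • z)) e (r₀ ^ (s * p) * L) :=
    pvFracPLap.comp_affine hr₀0 (by rwa [zero_add, hre])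
  refine hv.le_of_touching (φ := fun ρ => |ρ ^ γ - 1| ^ (p - 2) * (ρ ^ γ - 1)) hσp (fun y => ?_)
    (hC e he1) (by positivity)
  rw [← abs_rpow_mul_self_const_mul hp (by positivity)]
  refine abs_rpow_mul_self_mono hp ?_
  have h1 := hmin (r₀ • y)
  rw [norm_smul, Real.norm_of_nonneg hr₀0.le, Real.mul_rpow hr₀0.le (norm_nonneg _)] at h1
  simp only [zero_add, hre]
  linarith

lemma le_norm_gradient_of_forall_add_rpow_le {E : Type*} [NormedAddCommGroup E]
    [InnerProductSpace ℝ E] [CompleteSpace E] {u : E → ℝ} {x₀ : E} {D γ : ℝ}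
    (hu : DifferentiableAt ℝ u x₀) (hx₀ : x₀ ≠ 0)
    (hmin : ∀ x, u x₀ + D * ‖x₀‖ ^ γ ≤ u x + D * ‖x‖ ^ γ) :
    γ * (D * ‖x₀‖ ^ γ) / ‖x₀‖ ≤ ‖gradient u x₀‖ := by
  have hr₀ : 0 < ‖x₀‖ := norm_pos_iff.2 hx₀
  set f : ℝ → ℝ := fun t => u (t • x₀) + D * (t ^ γ * ‖x₀‖ ^ γ) with hf
  have hd : HasDerivAt f (fderiv ℝ u x₀ x₀ + D * (γ * ‖x₀‖ ^ γ)) 1 := by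
    have h1 : HasDerivAt (fun t : ℝ => t • x₀) x₀ 1 := by
      simpa using (hasDerivAt_id (1 : ℝ)).smul_const x₀
    have h2 : HasFDerivAt u (fderiv ℝ u x₀) ((1 : ℝ) • x₀) := by
      rw [one_smul]
      exact hu.hasFDerivAt
    have h3 : HasDerivAt (fun t : ℝ => t ^ γ) γ 1 := by
      simpa using Real.hasDerivAt_rpow_const (x := 1) (p := γ) (Or.inl one_ne_zero)
    exact (h2.comp_hasDerivAt 1 h1).add ((h3.mul_const _).const_mul D)
  have hloc : IsLocalMin f 1 := by
    filter_upwards [lt_mem_nhds (show (0 : ℝ) < 1 by norm_num)] with t ht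
    have h1 := hmin (t • x₀)
    rw [norm_smul, Real.norm_of_nonneg ht.le, Real.mul_rpow ht.le hr₀.le] at h1
    simpa [hf] using h1
  have h0 := hloc.hasDerivAt_eq_zero hd
  have h1 : ‖gradient u x₀‖ = ‖fderiv ℝ u x₀‖ := LinearIsometryEquiv.norm_map _ _
  rw [h1, div_le_iff₀ hr₀]
  have h2 := (fderiv ℝ u x₀).le_opNorm x₀
  have h3 := neg_abs_le (fderiv ℝ u x₀ x₀)
  rw [Real.norm_eq_abs] at h2
  linarith

lemma exists_isMin_add_rpow {E : Type*} [NormedAddCommGroup E] [ProperSpace E] {v : E → ℝ}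
    (hv : Continuous v) (hpos : ∀ x, 0 < v x) (hinf : ∀ a > 0, ∃ x, v x < a) {γ : ℝ}
    (hγ : 0 < γ) {R : ℝ} (hR : 0 ≤ R) :
    ∃ D > 0, ∃ x₀, R < ‖x₀‖ ∧ v x₀ ≤ v 0 ∧ ∀ x, v x₀ + D * ‖x₀‖ ^ γ ≤ v x + D * ‖x‖ ^ γ := by
  obtain ⟨z, hz, hzmin⟩ := (isCompact_closedBall (0 : E) R).exists_isMinOn
    ⟨0, Metric.mem_closedBall_self hR⟩ hv.continuousOn
  obtain ⟨y, hy⟩ := hinf (v z) (hpos z)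
  set D := (v z - v y) / (2 * (‖y‖ ^ γ + 1)) with hD
  have hyγ : 0 ≤ ‖y‖ ^ γ := by positivity
  have hD0 : 0 < D := div_pos (by linarith) (by positivity)
  have hDy : v y + D * ‖y‖ ^ γ < v z := by
    have h1 : D * (2 * (‖y‖ ^ γ + 1)) = v z - v y := div_mul_cancel₀ _ (by positivity)
    nlinarith
  have hc : Continuous fun x : E => v x + D * ‖x‖ ^ γ :=
    hv.add (continuous_const.mul (continuous_norm.rpow_const fun x => Or.inr hγ.le))
  have hlim : Tendsto (fun x : E => D * ‖x‖ ^ γ) (cocompact E) atTop :=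
    ((tendsto_rpow_atTop hγ).comp tendsto_norm_cocompact_atTop).const_mul_atTop hD0
  obtain ⟨x₀, hx₀⟩ := hc.exists_forall_le' y (by
    filter_upwards [hlim.eventually_ge_atTop (v y + D * ‖y‖ ^ γ)] with x hx
    linarith [hpos x])
  have hD₀ : 0 ≤ D * ‖x₀‖ ^ γ := by positivity
  have hlt : v x₀ < v z := by linarith [hx₀ y]
  refine ⟨D, hD0, x₀, ?_, hlt.le.trans (hzmin (Metric.mem_closedBall_self hR)), hx₀⟩
  by_contra! h
  exact hlt.not_ge (hzmin (mem_closedBall_zero_iff.2 h))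

lemma rpow_mul_rpow_le_of_gradient_bound {σ p t m γ q V r κ L M G : ℝ} (hp : m ≤ p - 1)
    (hm : 0 ≤ m) (hγ : 0 < γ) (hq : 0 < q) (hV : 0 < V) (hr : 0 < r) (hκ : 0 < κ) (hM : 0 ≤ M)
    (hL : r ^ σ * L ≤ q ^ (p - 1) * M) (hVL : V ^ t * G ^ m ≤ L) (hG : γ * q / r ≤ G)
    (hVq : κ * q ≤ V) :
    V ^ (t + m - (p - 1)) * r ^ (σ - m) ≤ M * κ ^ (-(p - 1 - m)) * γ ^ (-m) := by
  have h1 : r ^ σ * (V ^ t * (γ * q / r) ^ m) ≤ q ^ (p - 1) * M :=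
    (mul_le_mul_of_nonneg_left ((mul_le_mul_of_nonneg_left
      (Real.rpow_le_rpow (by positivity) hG hm) (by positivity)).trans hVL) (by positivity)).trans hL
  have h2 : (γ * q / r) ^ m = γ ^ m * q ^ m * r ^ (-m) := by
    rw [Real.div_rpow (by positivity) hr.le, Real.mul_rpow hγ.le hq.le, Real.rpow_neg hr.le]
    rfl
  have h3 : q ^ (p - 1) = q ^ m * q ^ (p - 1 - m) := by
    rw [← Real.rpow_add hq]
    ring_nf
  have h4 : q ^ (p - 1 - m) ≤ κ ^ (-(p - 1 - m)) * V ^ (p - 1 - m) := by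
    have h5 : q ≤ κ⁻¹ * V := by
      rw [inv_mul_eq_div, le_div_iff₀ hκ]
      linarith
    refine (Real.rpow_le_rpow hq.le h5 (by linarith)).trans_eq ?_
    rw [Real.mul_rpow (by positivity) hV.le, Real.inv_rpow hκ.le, Real.rpow_neg hκ.le]
  have h6 : r ^ σ * r ^ (-m) = r ^ (σ - m) := by rw [← Real.rpow_add hr, sub_eq_add_neg]
  have h7 : V ^ t = V ^ (t + m - (p - 1)) * V ^ (p - 1 - m) := by
    rw [← Real.rpow_add hV]
    ring_nf
  have hqm : 0 < q ^ m := by positivity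
  have hVm : 0 < V ^ (p - 1 - m) := by positivity
  have hγm : 0 < γ ^ m := by positivity
  have h8 : q ^ m * (V ^ (p - 1 - m) * γ ^ m) * (V ^ (t + m - (p - 1)) * r ^ (σ - m)) ≤
      q ^ m * (V ^ (p - 1 - m) * γ ^ m) * (M * κ ^ (-(p - 1 - m)) * γ ^ (-m)) := by
    calc _ = r ^ σ * (V ^ t * (γ * q / r) ^ m) := by
          rw [h2, h7, ← h6]
          ring
      _ ≤ q ^ m * q ^ (p - 1 - m) * M := by rwa [← h3]
      _ ≤ q ^ m * (κ ^ (-(p - 1 - m)) * V ^ (p - 1 - m)) * M := by gcongr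
      _ = _ := by
          rw [Real.rpow_neg hγ.le]
          field_simp
  exact le_of_mul_le_mul_left h8 (by positivity)

lemma exists_decay_exponent {n σ p t m : ℝ} (hp : 1 < p) (hσ : σ < n)
    (hsub : t * (n - σ) + m * (n - (σ - p + 1)) < n * (p - 1)) :
    ∃ β > 0, n - σ < β * (p - 1) ∧ β * (t + m - (p - 1)) < σ - m := by
  have hp0 : 0 < p - 1 := by linarith
  set τ := t + m - (p - 1) with hτ
  have hα : (n - σ) / (p - 1) * τ < σ - m := by
    rw [div_mul_eq_mul_div, div_lt_iff₀ hp0]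
    nlinarith
  have hlim : Tendsto (fun β : ℝ => β * τ)
      (nhdsWithin ((n - σ) / (p - 1)) (Ioi ((n - σ) / (p - 1)))) (nhds ((n - σ) / (p - 1) * τ)) :=
    (tendsto_id.mul_const τ).mono_left nhdsWithin_le_nhds
  obtain ⟨β, h1, h2⟩ := ((hlim.eventually_lt_const hα).and self_mem_nhdsWithin).exists
  exact ⟨β, (div_pos (by linarith) hp0).trans h2, (div_lt_iff₀ hp0).1 h2, h1⟩

/-- A positive supersolution cannot have infimum `0`. -/
lemma false_of_forall_pos_of_forall_exists_lt {N : ℕ} (hN : 1 ≤ N) {s p t m : ℝ} (hs : 0 < s)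
    (hs1 : s < 1) (hp : 1 < p) (hNsp : s * p < N) (hm : 0 ≤ m) (hmp : m ≤ p - 1)
    (hmσ : m < s * p) (hsub : t * (N - s * p) + m * ((N : ℝ) - (s * p - p + 1)) < N * (p - 1))
    {v : EuclideanSpace ℝ (Fin N) → ℝ} (hv : Differentiable ℝ v) (hpos : ∀ x, 0 < v x)
    (hinf : ∀ a > 0, ∃ x, v x < a)
    (hL : ∀ x, ∃ L, pvFracPLap N s p v x L ∧ v x ^ t * ‖gradient v x‖ ^ m ≤ L) : False := by
  have hp0 : 0 < p - 1 := by linarith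
  have hσ : 0 < s * p := by positivity
  obtain ⟨β, hβ, hβσ, hβτ⟩ := exists_decay_exponent hp hNsp hsub
  set τ := t + m - (p - 1) with hτ
  obtain ⟨γ, hγ, hγ1, hγσ⟩ : ∃ γ > 0, γ ≤ 1 ∧ γ * (p - 1) < s * p := by
    have h : 0 < s * p / (p - 1) := by positivity
    refine ⟨min 1 (s * p / (p - 1) / 2), by positivity, min_le_left _ _, ?_⟩
    rw [← lt_div_iff₀ hp0]
    exact (min_le_right _ _).trans_lt (by linarith)
  obtain ⟨κ, hκ, hlow⟩ := exists_power_lower_bound hN hp hs hs1 hNsp hβ hβσ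
  obtain ⟨M, hM, hup⟩ := exists_growing_upper_bound hN hp hs hs1 hNsp hγ hγ1 hγσ
  have hvlow := hlow v hv.continuous (fun x => (hpos x).le) fun x => by
    obtain ⟨L, h1, h2⟩ := hL x
    exact ⟨L, le_trans (mul_nonneg (Real.rpow_nonneg (hpos x).le _) (by positivity)) h2, h1⟩
  obtain ⟨z, -, hz⟩ := (isCompact_closedBall (0 : EuclideanSpace ℝ (Fin N)) 1).exists_isMinOn
    ⟨0, Metric.mem_closedBall_self zero_le_one⟩ hv.continuous.continuousOn
  have hdecay : ∀ x, 1 ≤ ‖x‖ → κ * v z * ‖x‖ ^ (-β) ≤ v x := fun x hx => by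
    simpa using hvlow 1 one_pos (v z) (fun x hx => hz (mem_closedBall_zero_iff.2 hx)) x hx
  set θ := 1 - (1 / 2 : ℝ) ^ γ with hθ
  have hθ0 : 0 < θ := by
    have := Real.rpow_lt_one (x := 1 / 2) (by norm_num) (by norm_num) hγ
    linarith
  set κ' := κ * θ * 2 ^ (-β) with hκ'
  have hκ'0 : 0 < κ' := by positivity
  set G := M * κ' ^ (-(p - 1 - m)) * γ ^ (-m) with hG
  have hmain : ∀ R ≥ 1, ∃ x, R < ‖x‖ ∧ v x ≤ v 0 ∧ v x ^ τ * ‖x‖ ^ (s * p - m) ≤ G := by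
    intro R hR
    obtain ⟨D, hD, x₀, hRx, hx0, hmin⟩ :=
      exists_isMin_add_rpow hv.continuous hpos hinf hγ (R := R) (by linarith)
    have hr : 0 < ‖x₀‖ := by linarith
    have hxne : x₀ ≠ 0 := norm_pos_iff.1 hr
    obtain ⟨L, hpv, hLx⟩ := hL x₀
    refine ⟨x₀, hRx, hx0, rpow_mul_rpow_le_of_gradient_bound hmp hm hγ
      (q := D * ‖x₀‖ ^ γ) (by positivity) (hpos x₀) hr hκ'0 hM (hup v D x₀ L hD hxne hmin hpv) hLx
      (le_norm_gradient_of_forall_add_rpow_le (hv x₀) hxne hmin) ?_⟩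
    have h1 := hvlow (‖x₀‖ / 2) (by positivity) (D * ‖x₀‖ ^ γ * θ) (fun x hx => by
      have h2 := hmin x
      have h3 : ‖x‖ ^ γ ≤ ‖x₀‖ ^ γ * (1 / 2) ^ γ := by
        rw [← Real.mul_rpow hr.le (by norm_num)]
        exact Real.rpow_le_rpow (norm_nonneg _) (by linarith) hγ.le
      have h4 := mul_le_mul_of_nonneg_left h3 hD.le
      have h5 := (hpos x₀).le
      rw [hθ]
      linarith) x₀ (by linarith)
    rw [div_div_cancel₀ hr.ne'] at h1
    refine le_of_eq_of_le ?_ h1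
    rw [hκ']
    ring
  obtain ⟨c, hc, η, hη, hfin⟩ : ∃ c > 0, ∃ η > (0 : ℝ), ∀ R ≥ 1, ∃ r > R, c * r ^ η ≤ G := by
    rcases le_or_gt 0 τ with hτ0 | hτ0
    · have hb : 0 < κ * v z := mul_pos hκ (hpos z)
      refine ⟨(κ * v z) ^ τ, by positivity, s * p - m - β * τ, by linarith, fun R hR => ?_⟩
      obtain ⟨x, h1, -, h2⟩ := hmain R hR
      have hr : 0 < ‖x‖ := by linarith
      refine ⟨‖x‖, h1, le_trans ?_ h2⟩
      have h3 := Real.rpow_le_rpow (by positivity) (hdecay x (by linarith)) hτ0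
      refine le_trans (le_of_eq ?_) (mul_le_mul_of_nonneg_right h3 (by positivity))
      rw [Real.mul_rpow hb.le (by positivity), ← Real.rpow_mul hr.le, mul_assoc,
        ← Real.rpow_add hr]
      ring_nf
    · refine ⟨v 0 ^ τ, Real.rpow_pos_of_pos (hpos 0) _, s * p - m, by linarith, fun R hR => ?_⟩
      obtain ⟨x, h1, h0, h2⟩ := hmain R hR
      exact ⟨‖x‖, h1, le_trans (mul_le_mul_of_nonneg_right
        (Real.rpow_le_rpow_of_nonpos (hpos x) h0 hτ0.le) (by positivity)) h2⟩
  obtain ⟨R, hR⟩ := eventually_atTop.1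
    (((tendsto_rpow_atTop hη).const_mul_atTop hc).eventually_gt_atTop G)
  obtain ⟨r, hr, h⟩ := hfin (max 1 R) (le_max_left _ _)
  exact (hR r ((le_max_right _ _).trans hr.le)).not_ge h

lemma gradient_sub_const {E : Type*} [NormedAddCommGroup E]
    [InnerProductSpace ℝ E] [CompleteSpace E] (u : E → ℝ) (c : ℝ) (x : E) :
    gradient (fun y => u y - c) x = gradient u x := by
  rw [gradient, gradient, fderiv_sub_const]

lemma pvFracPLap.sub_const {N : ℕ} {s p : ℝ} {u : EuclideanSpace ℝ (Fin N) → ℝ}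
    {x : EuclideanSpace ℝ (Fin N)} {L : ℝ} (h : pvFracPLap N s p u x L) (c : ℝ) :
    pvFracPLap N s p (fun y => u y - c) x L := by
  simpa only [pvFracPLap, sub_sub_sub_cancel_right] using h

lemma forall_pos_of_exists_pos {N : ℕ} (hN : 1 ≤ N) {s p : ℝ} (hp : 1 < p) (hs : 0 < s)
    (hs1 : s < 1) (hsN : s * p < N) {v : EuclideanSpace ℝ (Fin N) → ℝ} (hv : Continuous v)
    (hv0 : ∀ x, 0 ≤ v x) (hL : ∀ x, ∃ L ≥ 0, pvFracPLap N s p v x L)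
    {x₀ : EuclideanSpace ℝ (Fin N)} (hx₀ : 0 < v x₀) (x : EuclideanSpace ℝ (Fin N)) : 0 < v x := by
  have hp0 : 0 < p - 1 := by linarith
  have hα : 0 < (N - s * p) / (p - 1) := div_pos (by linarith) hp0
  obtain ⟨κ, hκ, hlow⟩ := exists_power_lower_bound hN hp hs hs1 hsN
    (β := (N - s * p) / (p - 1) + 1) (by linarith)
    (by rw [add_mul, div_mul_cancel₀ _ hp0.ne']; linarith)
  obtain ⟨R, hR, hball⟩ := Metric.nhds_basis_closedBall.eventually_iff.1
    (hv.continuousAt.eventually (lt_mem_nhds (half_lt_self hx₀)))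
  have hle : ∀ z, ‖z‖ ≤ R → v x₀ / 2 ≤ v (x₀ + z) := fun z hz =>
    (hball (by simpa [dist_eq_norm] using hz)).le
  rcases le_total ‖x - x₀‖ R with h | h
  · have := hle (x - x₀) h
    rw [add_sub_cancel] at this
    linarith
  · have h1 := hlow (fun z => v (x₀ + z)) (by fun_prop) (fun z => hv0 _) (fun z => by
      obtain ⟨L, h0, h1⟩ := hL (x₀ + z)
      have h2 := pvFracPLap.comp_affine (x₀ := x₀) (e := z) one_pos (by rwa [one_smul])
      simp only [one_smul, Real.one_rpow, one_mul] at h2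
      exact ⟨L, h0, h2⟩) R hR _ hle (x - x₀) h
    rw [add_sub_cancel] at h1
    have h2 : 0 < ‖x - x₀‖ / R := div_pos (lt_of_lt_of_le hR h) hR
    exact lt_of_lt_of_le (by positivity) h1

/-- Liouville theorem for nonnegative supersolutions of
`(-Δ_p)^s u ≥ u^t |∇u|^m` in `ℝ^N`. -/
theorem stmt_0 (N : ℕ) (hN : 2 ≤ N) (s p t m : ℝ)
    (hs : 0 < s) (hs1 : s < 1) (hp : 1 < p)
    (hNsp : s * p < N)
    (ht : 0 ≤ t) (hm : 0 ≤ m)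
    (hM : (p - 1 < s * p ∧ m ≤ p - 1) ∨ (s * p ≤ p - 1 ∧ m < s * p))
    (hsub : t * (N - s * p) + m * ((N : ℝ) - (s * p - p + 1)) < N * (p - 1))
    (u : EuclideanSpace ℝ (Fin N) → ℝ) (hu0 : ∀ x, 0 ≤ u x)
    (hu1 : ContDiff ℝ 1 u)
    (L : EuclideanSpace ℝ (Fin N) → ℝ)
    (hL : ∀ x, pvFracPLap N s p u x (L x))
    (hineq : ∀ x, u x ^ t * ‖gradient u x‖ ^ m ≤ L x) :
    ∃ c : ℝ, ∀ x, u x = c := by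
  have hN1 : 1 ≤ N := by omega
  obtain ⟨hmp, hmσ⟩ : m ≤ p - 1 ∧ m < s * p := by
    rcases hM with h | h
    · exact ⟨h.2, h.2.trans_lt h.1⟩
    · exact ⟨h.2.le.trans h.1, h.2⟩
  have hbdd : BddBelow (range u) := ⟨0, by rintro _ ⟨x, rfl⟩; exact hu0 x⟩
  refine ⟨⨅ x, u x, ?_⟩
  by_contra! hne
  obtain ⟨x₀, hx₀⟩ := hne
  set v : EuclideanSpace ℝ (Fin N) → ℝ := fun x => u x - ⨅ x, u x with hv
  have hv0 : ∀ x, 0 ≤ v x := fun x => sub_nonneg.2 (ciInf_le hbdd x)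
  have hvd : Differentiable ℝ v := (hu1.differentiable (by norm_num)).sub_const _
  have hvu : ∀ x, v x ≤ u x := fun x => sub_le_self _ (le_ciInf hu0)
  have hvL : ∀ x, pvFracPLap N s p v x (L x) := fun x => (hL x).sub_const _
  have hL0 : ∀ x, 0 ≤ L x := fun x =>
    (mul_nonneg (Real.rpow_nonneg (hu0 x) _) (by positivity)).trans (hineq x)
  have hpos : ∀ x, 0 < v x :=
    forall_pos_of_exists_pos hN1 hp hs hs1 hNsp hvd.continuous hv0 (fun x => ⟨L x, hL0 x, hvL x⟩)
      (lt_of_le_of_ne (hv0 x₀) (sub_ne_zero.2 hx₀).symm)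
  refine false_of_forall_pos_of_forall_exists_lt hN1 hs hs1 hp hNsp hm hmp hmσ hsub hvd hpos
    (fun a ha => ?_) fun x => ⟨L x, hvL x, le_trans ?_ (hineq x)⟩
  · obtain ⟨x, hx⟩ := exists_lt_of_ciInf_lt (lt_add_of_pos_right (⨅ x, u x) ha)
    exact ⟨x, by simp only [hv]; linarith⟩
  · rw [hv, gradient_sub_const]
    exact mul_le_mul_of_nonneg_right (Real.rpow_le_rpow (hv0 x) (hvu x) ht) (by positivity)
end

section
/- Let 0 < s < 1 < p, N ≥ 1, let Ω ⊆ ℝ^N be a bounded open set, and let f : Ω × ℝ^N → ℝ. Let u, v : ℝ^N → ℝ be such that v − u is upper semicontinuous on ℝ^N, u and v are differentiable at every point of Ω, and suppose that for every x ∈ Ω both (−Δ_p)^s u(x) and (−Δ_p)^s v(x) exist in the principal-value sense with values L_u(x) and L_v(x) satisfying L_u(x) ≥ f(x, ∇u(x)) and L_v(x) < f(x, ∇v(x)). If u ≥ v on ℝ^N ∖ Ω, then u ≥ v on all of ℝ^N. -/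
open MeasureTheory Filter Set

/-- For `p > 1` the function `t ↦ |t| ^ (p - 2) * t` is monotone on `ℝ`. -/
theorem monotone_abs_rpow_mul_self {p : ℝ} (hp : 1 < p) :
    Monotone fun t : ℝ => |t| ^ (p - 2) * t := by
  have key : ∀ t : ℝ, 0 ≤ t → |t| ^ (p - 2) * t = t ^ (p - 1) := by
    intro t ht
    rcases ht.eq_or_lt with rfl | ht
    · rw [mul_zero, Real.zero_rpow (by linarith)]
    · rw [abs_of_pos ht, ← Real.rpow_add_one ht.ne']
      congr 1
      ring
  refine monotone_of_odd_of_monotoneOn_nonneg (fun t => ?_) (fun a ha b hb hab => ?_)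
  · rw [abs_neg, mul_neg]
  · simp only [mem_Ici] at ha hb
    simp only [key a ha, key b hb]
    exact Real.rpow_le_rpow ha hab (by linarith)

/-- If `v - u` has a global maximum at `x`, then the fractional `p`-Laplacian of `u` at `x` is at
most that of `v`. -/
theorem pvFracPLap_le_of_sub_le {N : ℕ} {s p : ℝ} (hp : 1 < p)
    {u v : EuclideanSpace ℝ (Fin N) → ℝ} {x : EuclideanSpace ℝ (Fin N)} {Lu Lv : ℝ}
    (hu : pvFracPLap N s p u x Lu) (hv : pvFracPLap N s p v x Lv)
    (h : ∀ y, v y - u y ≤ v x - u x) : Lu ≤ Lv := by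
  refine le_of_tendsto_of_tendsto hu.2 hv.2 ?_
  filter_upwards [self_mem_nhdsWithin] with r hr
  refine integral_mono (hu.1 r hr) (hv.1 r hr) fun y => ?_
  refine mul_le_mul_of_nonneg_right ?_ (Real.rpow_nonneg (norm_nonneg _) _)
  exact monotone_abs_rpow_mul_self hp (by linarith [h y])

/-- An upper semicontinuous function that is nonpositive outside a bounded set and positive
somewhere attains its maximum at a point of that set. -/
theorem UpperSemicontinuous.exists_forall_le_of_nonpos_compl {X : Type*} [PseudoMetricSpace X]
    [ProperSpace X] {w : X → ℝ} (hw : UpperSemicontinuous w) {Ω : Set X}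
    (hΩ : Bornology.IsBounded Ω) (hout : ∀ x ∉ Ω, w x ≤ 0) {x₀ : X} (hx₀ : 0 < w x₀) :
    ∃ x ∈ Ω, ∀ y, w y ≤ w x := by
  have mem : ∀ x, 0 < w x → x ∈ Ω := fun x hx => by
    by_contra hn
    exact (hout x hn).not_gt hx
  obtain ⟨x, -, hmax⟩ := (hw.upperSemicontinuousOn (closure Ω)).exists_isMaxOn
    ⟨x₀, subset_closure (mem x₀ hx₀)⟩ hΩ.isCompact_closure
  have hpos : 0 < w x := hx₀.trans_le (hmax (subset_closure (mem x₀ hx₀)))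
  refine ⟨x, mem x hpos, fun y => ?_⟩
  by_cases hy : y ∈ Ω
  · exact hmax (subset_closure hy)
  · exact (hout y hy).trans hpos.le

/-- Comparison principle on a bounded open set for the fractional p-Laplacian
with gradient-dependent right-hand side. -/
theorem stmt_1 (N : ℕ) (hN : 1 ≤ N) (s p : ℝ)
    (hs : 0 < s) (hs1 : s < 1) (hp : 1 < p)
    (Ω : Set (EuclideanSpace ℝ (Fin N))) (hΩo : IsOpen Ω)
    (hΩb : Bornology.IsBounded Ω)
    (f : EuclideanSpace ℝ (Fin N) → EuclideanSpace ℝ (Fin N) → ℝ)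
    (u v : EuclideanSpace ℝ (Fin N) → ℝ)
    (husc : UpperSemicontinuous (fun x => v x - u x))
    (hud : ∀ x ∈ Ω, DifferentiableAt ℝ u x)
    (hvd : ∀ x ∈ Ω, DifferentiableAt ℝ v x)
    (Lu Lv : EuclideanSpace ℝ (Fin N) → ℝ)
    (hLu : ∀ x ∈ Ω, pvFracPLap N s p u x (Lu x))
    (hLv : ∀ x ∈ Ω, pvFracPLap N s p v x (Lv x))
    (hu : ∀ x ∈ Ω, f x (gradient u x) ≤ Lu x)
    (hv : ∀ x ∈ Ω, Lv x < f x (gradient v x))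
    (hout : ∀ x ∉ Ω, v x ≤ u x) :
    ∀ x, v x ≤ u x := by
  by_contra! hcon
  obtain ⟨x₀, hx₀⟩ := hcon
  obtain ⟨x, hxΩ, hmax⟩ := husc.exists_forall_le_of_nonpos_compl hΩb
    (fun x hx => sub_nonpos.2 (hout x hx)) (sub_pos.2 hx₀)
  have hgrad : gradient v x = gradient u x := by
    have h : fderiv ℝ (fun y => v y - u y) x = 0 :=
      IsLocalMax.fderiv_eq_zero (Eventually.of_forall hmax)
    rw [fderiv_fun_sub (hvd x hxΩ) (hud x hxΩ), sub_eq_zero] at h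
    rw [gradient, gradient, h]
  have hle := pvFracPLap_le_of_sub_le hp (hLu x hxΩ) (hLv x hxΩ) hmax
  have hlt := hv x hxΩ
  rw [hgrad] at hlt
  linarith [hu x hxΩ]
end

section
/- Let N ≥ 2, 0 < s < 1 < p, N > sp, and θ ∈ (0, (N−sp)/(p−1)]. Let φ_θ be the truncated power function with parameter ε₀ = 1/2. Then there exists a constant C > 0 such that for every x ∈ ℝ^N with |x| ≥ 1, the fractional p-Laplacian (−Δ_p)^s φ_θ(x) exists in the principal-value sense with a value that is at most C |x|^{−θ(p−1)−sp}. -/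
open MeasureTheory Filter Set

/-- The truncated power function `φ_θ` with truncation parameter `ε₀`:
`φ_θ(x) = |x|^{-θ}` for `|x| ≥ ε₀` and `φ_θ(x) = ε₀^{-θ}` for `|x| < ε₀`. -/
noncomputable def truncPow (N : ℕ) (θ ε₀ : ℝ) (x : EuclideanSpace ℝ (Fin N)) : ℝ :=
  if ε₀ ≤ ‖x‖ then ‖x‖ ^ (-θ) else ε₀ ^ (-θ)

lemma rpow_sub_two_mul_self {p a : ℝ} (hp : 1 < p) (ha : 0 ≤ a) :
    a ^ (p - 2) * a = a ^ (p - 1) := by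
  rcases ha.eq_or_lt with rfl | ha
  · rw [mul_zero, Real.zero_rpow (by linarith)]
  · rw [← Real.rpow_add_one ha.ne']; ring_nf

lemma abs_signedPow {p : ℝ} (hp : 1 < p) (a : ℝ) :
    |(|a| ^ (p - 2) * a)| = |a| ^ (p - 1) := by
  rw [abs_mul, abs_of_nonneg (by positivity), rpow_sub_two_mul_self hp (abs_nonneg a)]

/-- To bound the difference of signed powers symmetrically, it suffices to treat
the cases of a common sign and of opposite signs. -/
lemma signedPow_sub_induction {P : ℝ → ℝ → Prop}
    (symm : ∀ a c, P a c → P c a) (neg : ∀ a c, P a c → P (-a) (-c))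
    (same : ∀ a c, 0 ≤ c → c ≤ a → P a c) (opp : ∀ a c, 0 ≤ a → 0 ≤ c → P a (-c))
    (a c : ℝ) : P a c := by
  have key : ∀ a c, 0 ≤ a → 0 ≤ c → P a c := by
    intro a c ha hc
    rcases le_total c a with h | h
    · exact same a c hc h
    · exact symm _ _ (same c a ha h)
  rcases le_total 0 a with ha | ha <;> rcases le_total 0 c with hc | hc
  · exact key a c ha hc
  · simpa using opp a (-c) ha (by linarith)
  · exact symm _ _ (by simpa using opp c (-a) hc (by linarith))
  · simpa using neg _ _ (key (-a) (-c) (by linarith) (by linarith))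

lemma abs_signedPow_sub_le_of_two_le {p M : ℝ} (hp : 2 ≤ p) (a c : ℝ) (ha : |a| ≤ M)
    (hc : |c| ≤ M) :
    |(|a| ^ (p - 2) * a - |c| ^ (p - 2) * c)| ≤ (p - 1) * M ^ (p - 2) * |a - c| := by
  revert ha hc
  refine signedPow_sub_induction (P := fun a c => |a| ≤ M → |c| ≤ M →
    |(|a| ^ (p - 2) * a - |c| ^ (p - 2) * c)| ≤ (p - 1) * M ^ (p - 2) * |a - c|)
    ?_ ?_ ?_ ?_ a c
  · intro a c h hc ha
    rw [abs_sub_comm, abs_sub_comm c a]; exact h ha hc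
  · intro a c h ha hc
    rw [abs_neg] at ha hc
    have := h ha hc
    rw [abs_neg, abs_neg, ← abs_neg (-a - -c), ← abs_neg (_ - _)]
    convert this using 2 <;> ring_nf
  · intro a c hc hca ha _
    have ha0 : 0 ≤ a := hc.trans hca
    rw [abs_of_nonneg ha0] at ha
    rw [abs_of_nonneg ha0, abs_of_nonneg hc, abs_of_nonneg (sub_nonneg.2 hca),
      abs_of_nonneg (by
        have := Real.rpow_le_rpow hc hca (by linarith : 0 ≤ p - 2)
        have : c ^ (p - 2) * c ≤ a ^ (p - 2) * a := by gcongr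
        linarith)]
    rcases ha0.eq_or_lt with rfl | hapos
    · obtain rfl : c = 0 := le_antisymm hca hc
      simp
    have hB := one_add_mul_self_le_rpow_one_add (s := c / a - 1) (p := p - 1)
      (by have : 0 ≤ c / a := by positivity
          linarith) (by linarith)
    rw [show 1 + (c / a - 1) = c / a by ring, Real.div_rpow hc ha0,
      le_div_iff₀ (by positivity)] at hB
    have hM : a ^ (p - 2) ≤ M ^ (p - 2) := Real.rpow_le_rpow ha0 ha (by linarith)
    rw [rpow_sub_two_mul_self (by linarith) ha0, rpow_sub_two_mul_self (by linarith) hc]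
    have h1 : a ^ (p - 1) - c ^ (p - 1) ≤ (p - 1) * a ^ (p - 2) * (a - c) := by
      have e : (1 + (p - 1) * (c / a - 1)) * a ^ (p - 1)
          = a ^ (p - 1) + (p - 1) * a ^ (p - 2) * (c - a) := by
        rw [← rpow_sub_two_mul_self (by linarith : 1 < p) ha0]; field_simp
      linarith
    refine h1.trans ?_
    have : 0 ≤ a - c := by linarith
    have : 0 ≤ p - 1 := by linarith
    gcongr
  · intro a c ha hc haM hcM
    rw [abs_of_nonneg ha] at haM
    rw [abs_neg, abs_of_nonneg hc] at hcM
    rw [abs_neg, abs_of_nonneg ha, abs_of_nonneg hc, sub_neg_eq_add, mul_neg, sub_neg_eq_add,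
      abs_of_nonneg (by positivity), abs_of_nonneg (by positivity)]
    have h1 : a ^ (p - 2) ≤ M ^ (p - 2) := Real.rpow_le_rpow ha haM (by linarith)
    have h2 : c ^ (p - 2) ≤ M ^ (p - 2) := Real.rpow_le_rpow hc hcM (by linarith)
    have hM : 0 ≤ M := ha.trans haM
    calc a ^ (p - 2) * a + c ^ (p - 2) * c ≤ M ^ (p - 2) * a + M ^ (p - 2) * c := by gcongr
      _ = 1 * M ^ (p - 2) * (a + c) := by ring
      _ ≤ _ := by gcongr; linarith

lemma abs_signedPow_sub_le_of_lt_two {p : ℝ} (hp : 1 < p) (hp2 : p < 2) (a c : ℝ)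
    (hac : a + c ≠ 0) :
    |(|a| ^ (p - 2) * a - |c| ^ (p - 2) * c)| ≤ 2 * |a + c| ^ (p - 2) * |a - c| := by
  revert hac
  refine signedPow_sub_induction (P := fun a c => a + c ≠ 0 →
    |(|a| ^ (p - 2) * a - |c| ^ (p - 2) * c)| ≤ 2 * |a + c| ^ (p - 2) * |a - c|)
    ?_ ?_ ?_ ?_ a c
  · intro a c h hac
    rw [abs_sub_comm, abs_sub_comm c a, add_comm c a]; exact h (by rwa [add_comm])
  · intro a c h hac
    have := h (by contrapose! hac; linarith)
    rw [abs_neg, abs_neg, ← abs_neg (-a - -c), ← abs_neg (_ - _), ← abs_neg (-a + -c)]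
    convert this using 2 <;> ring_nf
  · intro a c hc hca hac
    have ha0 : 0 ≤ a := hc.trans hca
    have hapos : 0 < a := by
      rcases ha0.eq_or_lt with rfl | h
      · exact absurd (by linarith [le_antisymm hca hc] : (0 : ℝ) + c = 0) hac
      · exact h
    rw [abs_of_nonneg ha0, abs_of_nonneg hc, abs_of_nonneg (sub_nonneg.2 hca),
      abs_of_nonneg (add_nonneg ha0 hc)]
    have h0 : c ^ (p - 2) * c ≤ a ^ (p - 2) * a := by
      rw [rpow_sub_two_mul_self hp ha0, rpow_sub_two_mul_self hp hc]
      exact Real.rpow_le_rpow hc hca (by linarith)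
    rw [abs_of_nonneg (by linarith)]
    have h1 : a ^ (p - 2) * c ≤ c ^ (p - 2) * c := by
      rcases hc.eq_or_lt with rfl | hcpos
      · simp
      · have := Real.rpow_le_rpow_of_nonpos hcpos hca (by linarith : p - 2 ≤ 0)
        gcongr
    have h2 : a ^ (p - 2) ≤ 2 * (a + c) ^ (p - 2) := by
      have h3 : a ^ (p - 2) ≤ ((a + c) / 2) ^ (p - 2) :=
        Real.rpow_le_rpow_of_nonpos (by positivity) (by linarith) (by linarith)
      rw [Real.div_rpow (by positivity) (by norm_num), div_eq_mul_inv,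
        ← Real.rpow_neg (by norm_num), mul_comm] at h3
      have h4 : (2 : ℝ) ^ (-(p - 2)) ≤ 2 ^ (1 : ℝ) :=
        Real.rpow_le_rpow_of_exponent_le (by norm_num) (by linarith)
      rw [Real.rpow_one] at h4
      exact h3.trans (by gcongr)
    have h3 : 0 ≤ a - c := by linarith
    calc a ^ (p - 2) * a - c ^ (p - 2) * c ≤ a ^ (p - 2) * (a - c) := by linarith
      _ ≤ _ := by gcongr
  · intro a c ha hc hac
    have hac' : 0 < |a + -c| := abs_pos.2 hac
    rw [abs_neg, abs_of_nonneg ha, abs_of_nonneg hc, sub_neg_eq_add, mul_neg, sub_neg_eq_add,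
      abs_of_nonneg (add_nonneg ha hc), rpow_sub_two_mul_self hp ha,
      rpow_sub_two_mul_self hp hc, abs_of_nonneg (by positivity)]
    have hle : |a + -c| ≤ a + c := abs_le.2 ⟨by linarith, by linarith⟩
    have h1 : (a + c) ^ (p - 2) ≤ |a + -c| ^ (p - 2) :=
      Real.rpow_le_rpow_of_nonpos hac' hle (by linarith)
    have h2 : a ^ (p - 1) ≤ (a + c) ^ (p - 1) :=
      Real.rpow_le_rpow ha (by linarith) (by linarith)
    have h3 : c ^ (p - 1) ≤ (a + c) ^ (p - 1) :=
      Real.rpow_le_rpow hc (by linarith) (by linarith)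
    rw [← rpow_sub_two_mul_self hp (add_nonneg ha hc)] at h2 h3
    calc a ^ (p - 1) + c ^ (p - 1) ≤ 2 * (a + c) ^ (p - 2) * (a + c) := by linarith
      _ ≤ _ := by gcongr

lemma rpow_neg_bounds {τ : ℝ} (hτ : 0 < τ) : ∃ K c : ℝ, 0 < K ∧ 0 < c ∧
    (∀ t ∈ Icc (1 / 4 : ℝ) (9 / 4), |t ^ (-τ) - 1| ≤ K * |t - 1|) ∧
    (∀ t ∈ Icc (1 / 4 : ℝ) (9 / 4), |t ^ (-τ) - 1 + τ * (t - 1)| ≤ K * (t - 1) ^ 2) ∧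
    (∀ t ∈ Icc (1 / 4 : ℝ) (9 / 4), ∀ u ∈ Icc (1 / 4 : ℝ) (9 / 4),
      c * |t - u| ≤ |t ^ (-τ) - u ^ (-τ)|) := by
  have hlip : ∀ σ : ℝ, 0 < σ → ∀ t ∈ Icc (1 / 4 : ℝ) (9 / 4), ∀ u ∈ Icc (1 / 4 : ℝ) (9 / 4),
      |t ^ (-σ) - u ^ (-σ)| ≤ σ * (1 / 4 : ℝ) ^ (-σ - 1) * |t - u| := by
    intro σ hσ t ht u hu
    refine (convex_Icc (1 / 4 : ℝ) (9 / 4)).norm_image_sub_le_of_norm_hasDerivWithin_le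
      (f := fun t : ℝ => t ^ (-σ)) (f' := fun t => -σ * t ^ (-σ - 1)) (fun y hy => ?_)
      (fun y hy => ?_) hu ht
    · exact (Real.hasDerivAt_rpow_const
        (Or.inl (by have := hy.1; linarith))).hasDerivWithinAt
    · have h0 : (0 : ℝ) < y := by have := hy.1; linarith
      rw [norm_mul, Real.norm_eq_abs, abs_neg, abs_of_pos hσ, Real.norm_of_nonneg (by positivity)]
      exact mul_le_mul_of_nonneg_left
        (Real.rpow_le_rpow_of_nonpos (by norm_num) hy.1 (by linarith)) hσ.le
  have h1m : (1 : ℝ) ∈ Icc (1 / 4 : ℝ) (9 / 4) := by constructor <;> norm_num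
  set K₁ := τ * (1 / 4 : ℝ) ^ (-τ - 1) with hK₁
  set K₂ := τ * ((τ + 1) * (1 / 4 : ℝ) ^ (-(τ + 1) - 1)) with hK₂
  refine ⟨K₁ + K₂, τ * (9 / 4 : ℝ) ^ (-τ - 1), by positivity, by positivity, ?_, ?_, ?_⟩
  · intro t ht
    have := hlip τ hτ t ht 1 h1m
    rw [Real.one_rpow] at this
    refine this.trans ?_
    gcongr
    have : 0 < K₂ := by positivity
    linarith
  · intro t ht
    have hsub : uIcc 1 t ⊆ Icc (1 / 4 : ℝ) (9 / 4) := uIcc_subset_Icc h1m ht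
    have := (convex_uIcc 1 t).norm_image_sub_le_of_norm_hasDerivWithin_le
      (f := fun t : ℝ => t ^ (-τ) - 1 + τ * (t - 1)) (f' := fun t => -τ * t ^ (-τ - 1) + τ * 1)
      (C := K₂ * |t - 1|) (x := 1) (y := t)
      (fun y hy => ?_) (fun y hy => ?_) left_mem_uIcc right_mem_uIcc
    · simp only [Real.one_rpow, sub_self, mul_zero, add_zero, sub_zero, Real.norm_eq_abs] at this
      refine this.trans ?_
      rw [mul_assoc, ← abs_mul, ← sq, abs_of_nonneg (sq_nonneg _)]
      gcongr
      have : 0 < K₁ := by positivity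
      linarith
    · have h0 : y ≠ 0 := by have := (hsub hy).1; intro h; linarith
      exact (((Real.hasDerivAt_rpow_const (Or.inl h0)).sub_const 1).add
        (((hasDerivAt_id y).sub_const 1).const_mul τ)).hasDerivWithinAt
    · have h2 := hlip (τ + 1) (by linarith) y (hsub hy) 1 h1m
      rw [Real.one_rpow] at h2
      have h3 : |y - 1| ≤ |t - 1| := abs_sub_left_of_mem_uIcc hy
      rw [Real.norm_eq_abs, show -τ * y ^ (-τ - 1) + τ * 1 = -(τ * (y ^ (-(τ + 1)) - 1)) by
        rw [show -(τ + 1) = -τ - 1 by ring]; ring, abs_neg, abs_mul, abs_of_pos hτ, hK₂,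
        mul_assoc]
      gcongr
      exact h2.trans (by gcongr)
  · have hlt : ∀ t ∈ Icc (1 / 4 : ℝ) (9 / 4), ∀ u ∈ Icc (1 / 4 : ℝ) (9 / 4), t < u →
        τ * (9 / 4 : ℝ) ^ (-τ - 1) * |t - u| ≤ |t ^ (-τ) - u ^ (-τ)| := by
      intro t ht u hu htu
      have hpos : ∀ y ∈ Icc t u, 0 < y := fun y hy => by linarith [ht.1, hy.1]
      obtain ⟨y, hy, hyd⟩ := exists_hasDerivAt_eq_slope (fun t : ℝ => t ^ (-τ))
        (fun t => -τ * t ^ (-τ - 1)) htu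
        (fun y hy => (Real.continuousAt_rpow_const _ _
          (Or.inl (hpos y hy).ne')).continuousWithinAt)
        (fun y hy => Real.hasDerivAt_rpow_const (Or.inl (hpos y (Ioo_subset_Icc_self hy)).ne'))
      have h4 : (9 / 4 : ℝ) ^ (-τ - 1) ≤ y ^ (-τ - 1) :=
        Real.rpow_le_rpow_of_nonpos (hpos y (Ioo_subset_Icc_self hy))
          (by linarith [hy.2, hu.2]) (by linarith)
      have hut : 0 < u - t := by linarith
      rw [eq_div_iff hut.ne'] at hyd
      rw [abs_sub_comm, abs_of_pos hut]
      refine le_trans ?_ (le_abs_self _)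
      have : τ * (9 / 4 : ℝ) ^ (-τ - 1) * (u - t) ≤ τ * y ^ (-τ - 1) * (u - t) := by gcongr
      linarith
    intro t ht u hu
    rcases lt_trichotomy t u with h | rfl | h
    · exact hlt t ht u hu h
    · simp
    · rw [abs_sub_comm, abs_sub_comm (t ^ (-τ))]
      exact hlt u hu t ht h

lemma integrableOn_abs_rpow_neg {γ : ℝ} (hγ : γ < 1) :
    IntegrableOn (fun x : ℝ => |x| ^ (-γ)) (Icc (-1) 1) := by
  have h : IntegrableOn (fun x : ℝ => |x| ^ (-γ)) (Icc 0 1) := by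
    have := (intervalIntegrable_iff_integrableOn_Icc_of_le zero_le_one).1
      (intervalIntegral.intervalIntegrable_rpow' (a := 0) (b := 1) (r := -γ) (by linarith))
    refine this.congr_fun (fun x hx => ?_) measurableSet_Icc
    simp only [abs_of_nonneg hx.1]
  have h' := h.comp_neg
  simp only [abs_neg, neg_Icc, neg_zero] at h'
  rw [← Icc_union_Icc_eq_Icc (by norm_num : (-1 : ℝ) ≤ 0) zero_le_one]
  exact h'.union h

lemma ae_forall_apply_ne_zero (N : ℕ) : ∀ᵐ z : EuclideanSpace ℝ (Fin N), ∀ i, z i ≠ 0 := by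
  have : ∀ᵐ x : Fin N → ℝ, ∀ i, x i ≠ 0 :=
    ae_all_iff.2 fun i => Measure.ae_eval_ne _ i 0
  exact (EuclideanSpace.volume_preserving_symm_measurableEquiv_toLp
    (Fin N)).quasiMeasurePreserving.ae this

lemma integrableOn_coord_rpow_mul_norm_rpow {N : ℕ} (i₀ : Fin N) {α β : ℝ} (hα1 : α < 1)
    (hβ : 0 ≤ β) (hαβ : α + β < N) :
    IntegrableOn (fun z : EuclideanSpace ℝ (Fin N) => |z i₀| ^ (-α) * ‖z‖ ^ (-β))
      {z | ‖z‖ ≤ 1} := by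
  set t : ℝ := β / (N - α) with ht
  have hden : 0 < (N : ℝ) - α := by linarith
  have ht0 : 0 ≤ t := by positivity
  have ht1 : t < 1 := by rw [ht, div_lt_one hden]; linarith
  let δ : Fin N → ℝ := fun i => t - (if i = i₀ then α * t else 0)
  let γ : Fin N → ℝ := fun i => δ i + (if i = i₀ then α else 0)
  have hδ0 : ∀ i, 0 ≤ δ i := by
    intro i
    by_cases h : i = i₀ <;> simp only [δ, h, if_true, if_false]
    · nlinarith
    · linarith
  have hγ1 : ∀ i, γ i < 1 := by
    intro i
    by_cases h : i = i₀ <;> simp only [γ, δ, h, if_true, if_false]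
    · nlinarith
    · linarith
  have hδs : ∑ i, δ i = β := by
    simp only [δ, Finset.sum_sub_distrib, Finset.sum_const, Finset.card_univ, Fintype.card_fin,
      Finset.sum_ite_eq', Finset.mem_univ, if_true, nsmul_eq_mul]
    rw [ht]; field_simp
  have hint : Integrable (fun x : Fin N → ℝ =>
      ∏ i, (Icc (-1 : ℝ) 1).indicator (fun y => |y| ^ (-γ i)) (x i)) :=
    Integrable.fintype_prod (f := fun i => (Icc (-1 : ℝ) 1).indicator (fun y => |y| ^ (-γ i)))
      fun i => (integrable_indicator_iff measurableSet_Icc).2 (integrableOn_abs_rpow_neg (hγ1 i))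
  have hmp := EuclideanSpace.volume_preserving_symm_measurableEquiv_toLp (Fin N)
  have hint' := hmp.integrable_comp_of_integrable hint
  have hms : MeasurableSet {z : EuclideanSpace ℝ (Fin N) | ‖z‖ ≤ 1} :=
    measurableSet_le measurable_norm measurable_const
  refine hint'.integrableOn.mono' ?_ ?_
  · exact Measurable.aestronglyMeasurable (by fun_prop)
  · rw [ae_restrict_iff' hms]
    filter_upwards [ae_forall_apply_ne_zero N] with z hz hz1
    have hz1 : ‖z‖ ≤ 1 := hz1
    have hle : ∀ i, |z i| ≤ ‖z‖ := fun i => PiLp.norm_apply_le z i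
    have hzpos : 0 < ‖z‖ := (abs_pos.2 (hz i₀)).trans_le (hle i₀)
    rw [Real.norm_of_nonneg (by positivity)]
    have e1 : ‖z‖ ^ (-β) = ∏ i, ‖z‖ ^ (-δ i) := by
      rw [← Real.rpow_sum_of_pos hzpos, Finset.sum_neg_distrib, hδs]
    have e2 : |z i₀| ^ (-α) = ∏ i, if i = i₀ then |z i| ^ (-α) else 1 := by simp
    rw [e1, e2, ← Finset.prod_mul_distrib]
    refine Finset.prod_le_prod (fun i _ => by split_ifs <;> positivity) fun i _ => ?_
    have hzi := abs_pos.2 (hz i)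
    rw [indicator_of_mem (by exact abs_le.1 ((hle i).trans hz1))]
    have h1 : ‖z‖ ^ (-δ i) ≤ |z i| ^ (-δ i) :=
      Real.rpow_le_rpow_of_nonpos hzi (hle i) (by linarith [hδ0 i])
    have h2 : |z i| ^ (-γ i) = (if i = i₀ then |z i| ^ (-α) else 1) * |z i| ^ (-δ i) := by
      split_ifs with h
      · rw [← Real.rpow_add hzi]; simp only [γ, h, if_true]; ring_nf
      · simp [γ, h]
    change _ ≤ |z i| ^ (-γ i)
    rw [h2]
    gcongr

lemma integrableOn_norm_rpow_neg_of_lt {N : ℕ} {σ r : ℝ} (hσ : 0 < σ) (hr : 0 < r) :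
    IntegrableOn (fun z : EuclideanSpace ℝ (Fin N) => ‖z‖ ^ (-((N : ℝ) + σ)))
      {z | r < ‖z‖} := by
  have h := integrable_one_add_norm (E := EuclideanSpace ℝ (Fin N)) (μ := volume)
    (r := (N : ℝ) + σ) (by simpa using hσ)
  refine ((h.const_mul ((r / (1 + r)) ^ (-((N : ℝ) + σ)))).integrableOn).mono'
    (Measurable.aestronglyMeasurable (by fun_prop)) ?_
  rw [ae_restrict_iff' (measurableSet_lt measurable_const measurable_norm)]
  refine ae_of_all _ fun z (hz : r < ‖z‖) => ?_
  rw [Real.norm_of_nonneg (by positivity), ← Real.mul_rpow (by positivity) (by positivity)]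
  refine Real.rpow_le_rpow_of_nonpos (by positivity) ?_ (by have : (0 : ℝ) ≤ N := by positivity
                                                            linarith)
  rw [div_mul_eq_mul_div, div_le_iff₀ (by positivity)]
  nlinarith

/-- Truncated integrals of a function whose symmetrization is integrable near the origin
converge as the truncation is removed. -/
lemma tendsto_integral_of_symm_integrable {N : ℕ} {g : EuclideanSpace ℝ (Fin N) → ℝ} {ρ : ℝ}
    (hρ : 0 < ρ) (hg : ∀ r : ℝ, 0 < r → IntegrableOn g {z | r < ‖z‖}) (h0 : g 0 = 0)
    (hS : IntegrableOn (fun z => g z + g (-z)) {z | ‖z‖ ≤ ρ}) :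
    Tendsto (fun r : ℝ => ∫ z in {z : EuclideanSpace ℝ (Fin N) | r < ‖z‖}, g z)
      (nhdsWithin 0 (Ioi 0))
      (nhds (1 / 2 * (∫ z in {z : EuclideanSpace ℝ (Fin N) | ‖z‖ ≤ ρ}, (g z + g (-z)))
        + ∫ z in {z : EuclideanSpace ℝ (Fin N) | ρ < ‖z‖}, g z)) := by
  have hm : ∀ r : ℝ, MeasurableSet {z : EuclideanSpace ℝ (Fin N) | r < ‖z‖} :=
    fun r => measurableSet_lt measurable_const measurable_norm
  have hm' : ∀ r : ℝ, MeasurableSet {z : EuclideanSpace ℝ (Fin N) | ‖z‖ ≤ r} :=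
    fun r => measurableSet_le measurable_norm measurable_const
  set B := {z : EuclideanSpace ℝ (Fin N) | ‖z‖ ≤ ρ} with hB
  have hlim : Tendsto (fun r : ℝ => ∫ z in B,
      {z : EuclideanSpace ℝ (Fin N) | r < ‖z‖}.indicator (fun z => g z + g (-z)) z)
      (nhdsWithin 0 (Ioi 0)) (nhds (∫ z in B, (g z + g (-z)))) := by
    refine tendsto_integral_filter_of_dominated_convergence (fun z => ‖g z + g (-z)‖)
      (Eventually.of_forall fun r => hS.aestronglyMeasurable.indicator (hm r))
      (Eventually.of_forall fun r => ae_of_all _ fun z => norm_indicator_le_norm_self _ _)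
      hS.norm (ae_of_all _ fun z => ?_)
    by_cases hz : z = 0
    · subst hz
      refine tendsto_const_nhds.congr fun r => ?_
      simp [indicator, h0]
    · have hz' : 0 < ‖z‖ := norm_pos_iff.2 hz
      refine tendsto_const_nhds.congr' ?_
      filter_upwards [nhdsWithin_le_nhds (Iio_mem_nhds hz')] with r hr
      rw [indicator_of_mem]
      exact hr
  refine ((hlim.const_mul (1 / 2)).add_const _).congr' ?_
  filter_upwards [self_mem_nhdsWithin, nhdsWithin_le_nhds (Iio_mem_nhds hρ)] with r hr hrρ
  have hr : 0 < r := hr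
  have hrρ : r < ρ := hrρ
  set A := {z : EuclideanSpace ℝ (Fin N) | r < ‖z‖} with hA
  have hsplit : A = (B ∩ A) ∪ {z | ρ < ‖z‖} := by
    ext z
    simp only [hA, hB, mem_union, mem_inter_iff, mem_ofPred_eq]
    constructor
    · intro h
      rcases le_or_gt ‖z‖ ρ with h' | h'
      · exact Or.inl ⟨h', h⟩
      · exact Or.inr h'
    · rintro (h | h)
      · exact h.2
      · linarith
  have hBA : IntegrableOn g (B ∩ A) := (hg r hr).mono_set inter_subset_right
  have hneg : -(B ∩ A) = B ∩ A := by ext z; simp [hA, hB]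
  have hBA' : IntegrableOn (fun z => g (-z)) (B ∩ A) := by
    simpa [hneg] using hBA.comp_neg
  have hinv : ∫ z in B ∩ A, g (-z) = ∫ z in B ∩ A, g z := by
    rw [← integral_indicator ((hm' ρ).inter (hm r)), ← integral_indicator ((hm' ρ).inter (hm r)),
      ← integral_neg_eq_self ((B ∩ A).indicator g)]
    congr 1
    ext z
    have : -z ∈ B ∩ A ↔ z ∈ B ∩ A := by rw [← Set.mem_neg, hneg]
    simp only [indicator, this]
    rfl
  rw [setIntegral_indicator (hm r), integral_add hBA hBA', hinv]
  conv_rhs => rw [hsplit]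
  rw [setIntegral_union _ (hm ρ) hBA (hg ρ hρ)]
  · ring
  · rw [Set.disjoint_left]
    exact fun z hz hz' => not_le_of_gt (show ρ < ‖z‖ from hz') hz.1

lemma exists_symm_bounds {N : ℕ} (i₀ : Fin N) {θ : ℝ} (hθ : 0 < θ) :
    ∃ K c : ℝ, 0 < K ∧ 0 < c ∧ ∀ z : EuclideanSpace ℝ (Fin N), ‖z‖ ≤ 1 / 2 →
      |1 - ‖EuclideanSpace.single i₀ (1 : ℝ) - z‖ ^ (-θ)| ≤ K * ‖z‖ ∧
      |(1 - ‖EuclideanSpace.single i₀ (1 : ℝ) - z‖ ^ (-θ)) +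
        (1 - ‖EuclideanSpace.single i₀ (1 : ℝ) - -z‖ ^ (-θ))| ≤ K * ‖z‖ ^ 2 ∧
      c * |z i₀| ≤ |(1 - ‖EuclideanSpace.single i₀ (1 : ℝ) - z‖ ^ (-θ)) -
        (1 - ‖EuclideanSpace.single i₀ (1 : ℝ) - -z‖ ^ (-θ))| := by
  obtain ⟨K, c, hK, hc, h1, h2, h3⟩ := rpow_neg_bounds (half_pos hθ)
  set e : EuclideanSpace ℝ (Fin N) := EuclideanSpace.single i₀ (1 : ℝ) with he
  have hen : ‖e‖ = 1 := by simp [he]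
  have hsq : ∀ z, ‖e - z‖ ^ 2 = 1 - 2 * z i₀ + ‖z‖ ^ 2 := by
    intro z
    rw [norm_sub_sq_real, hen, he, EuclideanSpace.inner_single_left]; simp
  have hpow : ∀ z, ‖e - z‖ ^ (-θ) = (‖e - z‖ ^ 2) ^ (-(θ / 2)) := by
    intro z
    rw [← Real.rpow_natCast, ← Real.rpow_mul (norm_nonneg _)]; congr 1; push_cast; ring
  have hmem : ∀ z, ‖z‖ ≤ 1 / 2 → ‖e - z‖ ^ 2 ∈ Icc (1 / 4 : ℝ) (9 / 4) := by
    intro z hz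
    have h4 : ‖e - z‖ ≤ 1 + ‖z‖ := by rw [← hen]; exact norm_sub_le e z
    have h5 : 1 - ‖z‖ ≤ ‖e - z‖ := by rw [← hen]; exact norm_sub_norm_le e z
    constructor <;> nlinarith [norm_nonneg (e - z)]
  refine ⟨12 * K + θ, 4 * c, by positivity, by positivity, fun z hz => ?_⟩
  have hz0 := norm_nonneg z
  have hzi : |z i₀| ≤ ‖z‖ := PiLp.norm_apply_le z i₀
  obtain ⟨hzi1, hzi2⟩ := abs_le.1 hzi
  have hm := hmem z hz
  have hm' := hmem (-z) (by rwa [norm_neg])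
  have s1 := hsq z
  have s2 := hsq (-z)
  rw [norm_neg, PiLp.neg_apply] at s2
  rw [hpow z, hpow (-z)]
  set t := ‖e - z‖ ^ 2
  set u := ‖e - -z‖ ^ 2
  have ht : |t - 1| ≤ 3 * ‖z‖ := by
    rw [abs_le]; constructor <;> nlinarith
  have hu : |u - 1| ≤ 3 * ‖z‖ := by
    rw [abs_le]; constructor <;> nlinarith
  refine ⟨?_, ?_, ?_⟩
  · rw [abs_sub_comm]
    calc _ ≤ K * |t - 1| := h1 t hm
      _ ≤ K * (3 * ‖z‖) := by gcongr
      _ ≤ _ := by nlinarith [mul_nonneg hK.le hz0, mul_nonneg hθ.le hz0]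
  · have b1 := abs_le.1 (h2 t hm)
    have b2 := abs_le.1 (h2 u hm')
    have q1 : K * (t - 1) ^ 2 + K * (u - 1) ^ 2 ≤ 12 * K * ‖z‖ ^ 2 := by
      have e1 : (t - 1) ^ 2 + (u - 1) ^ 2 = 8 * z i₀ ^ 2 + 2 * (‖z‖ ^ 2) ^ 2 := by
        rw [s1, s2]; ring
      have e2 : z i₀ ^ 2 ≤ ‖z‖ ^ 2 := sq_le_sq' hzi1 hzi2
      have e3 : ‖z‖ ^ 2 ≤ 1 := by nlinarith
      have e4 : (t - 1) ^ 2 + (u - 1) ^ 2 ≤ 12 * ‖z‖ ^ 2 := by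
        rw [e1]; nlinarith [sq_nonneg ‖z‖]
      calc K * (t - 1) ^ 2 + K * (u - 1) ^ 2 = K * ((t - 1) ^ 2 + (u - 1) ^ 2) := by ring
        _ ≤ K * (12 * ‖z‖ ^ 2) := by gcongr
        _ = _ := by ring
    have q2 : θ / 2 * (t - 1) + θ / 2 * (u - 1) = θ * ‖z‖ ^ 2 := by rw [s1, s2]; ring
    have : 0 ≤ θ * ‖z‖ ^ 2 := by positivity
    rw [abs_le]
    constructor <;> linarith
  · have h4 := h3 t hm u hm'
    rw [show t - u = -(4 * z i₀) by rw [s1, s2]; ring, abs_neg, abs_mul,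
      abs_of_pos (by norm_num : (0 : ℝ) < 4)] at h4
    rw [sub_sub_sub_cancel_left, abs_sub_comm]
    linarith

lemma integrableOn_symm {N : ℕ} (hN : 2 ≤ N) (i₀ : Fin N) {s p θ : ℝ} (hs : 0 < s)
    (hs1 : s < 1) (hp : 1 < p) (hθ : 0 < θ) {Ψ : EuclideanSpace ℝ (Fin N) → ℝ}
    (hΨ : ∀ z, Ψ z = |1 - ‖EuclideanSpace.single i₀ (1 : ℝ) - z‖ ^ (-θ)| ^ (p - 2) *
      (1 - ‖EuclideanSpace.single i₀ (1 : ℝ) - z‖ ^ (-θ)) * ‖z‖ ^ (-((N : ℝ) + s * p))) :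
    IntegrableOn (fun z => Ψ z + Ψ (-z)) {z | ‖z‖ ≤ 1 / 2} := by
  obtain ⟨K, c, hK, hc, hb⟩ := exists_symm_bounds i₀ hθ
  have hN' : (2 : ℝ) ≤ N := by exact_mod_cast hN
  have hsp : 0 < s * p := by positivity
  have hspp : s * p < p := by nlinarith
  have hΨm : Measurable Ψ := by
    rw [funext hΨ]; fun_prop
  have hms : MeasurableSet {z : EuclideanSpace ℝ (Fin N) | ‖z‖ ≤ 1 / 2} :=
    measurableSet_le measurable_norm measurable_const
  obtain ⟨α, β, C, hα1, hβ, hαβ, hle⟩ : ∃ α β C : ℝ, α < 1 ∧ 0 ≤ β ∧ α + β < N ∧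
      ∀ z : EuclideanSpace ℝ (Fin N), ‖z‖ ≤ 1 / 2 → z i₀ ≠ 0 →
        |Ψ z + Ψ (-z)| ≤ C * (|z i₀| ^ (-α) * ‖z‖ ^ (-β)) := by
    have hfac : ∀ z, Ψ z + Ψ (-z) =
        (|1 - ‖EuclideanSpace.single i₀ (1 : ℝ) - z‖ ^ (-θ)| ^ (p - 2) *
          (1 - ‖EuclideanSpace.single i₀ (1 : ℝ) - z‖ ^ (-θ)) -
        |-(1 - ‖EuclideanSpace.single i₀ (1 : ℝ) - -z‖ ^ (-θ))| ^ (p - 2) *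
          -(1 - ‖EuclideanSpace.single i₀ (1 : ℝ) - -z‖ ^ (-θ))) *
        ‖z‖ ^ (-((N : ℝ) + s * p)) := by
      intro z
      rw [hΨ, hΨ, abs_neg, norm_neg]; ring
    rcases lt_or_ge p 2 with hp2 | hp2
    · refine ⟨2 - p, N + s * p - 2, 2 * c ^ (p - 2) * K, by linarith, by linarith, by linarith,
        fun z hz hzi => ?_⟩
      obtain ⟨-, hab, hsub⟩ := hb z hz
      have hzi' := abs_pos.2 hzi
      have hzpos : 0 < ‖z‖ := hzi'.trans_le (PiLp.norm_apply_le z i₀)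
      rw [hfac, abs_mul, abs_of_nonneg (by positivity : 0 ≤ ‖z‖ ^ (-((N : ℝ) + s * p)))]
      set a := 1 - ‖EuclideanSpace.single i₀ (1 : ℝ) - z‖ ^ (-θ)
      set b := 1 - ‖EuclideanSpace.single i₀ (1 : ℝ) - -z‖ ^ (-θ)
      have hab0 : a + -b ≠ 0 := by
        rw [← sub_eq_add_neg]
        exact abs_pos.1 (lt_of_lt_of_le (by positivity) hsub)
      have h1 := abs_signedPow_sub_le_of_lt_two hp hp2 a (-b) hab0
      rw [← sub_eq_add_neg, sub_neg_eq_add] at h1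
      have h2 : |a - b| ^ (p - 2) ≤ c ^ (p - 2) * |z i₀| ^ (p - 2) := by
        rw [← Real.mul_rpow hc.le (abs_nonneg _)]
        exact Real.rpow_le_rpow_of_nonpos (by positivity) hsub (by linarith)
      have h3 : ‖z‖ ^ 2 * ‖z‖ ^ (-((N : ℝ) + s * p)) = ‖z‖ ^ (-(N + s * p - 2)) := by
        rw [← Real.rpow_natCast, ← Real.rpow_add hzpos]; congr 1; push_cast; ring
      calc _ ≤ 2 * (c ^ (p - 2) * |z i₀| ^ (p - 2)) * (K * ‖z‖ ^ 2) *
            ‖z‖ ^ (-((N : ℝ) + s * p)) := by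
            gcongr
            exact h1.trans (by gcongr)
        _ = 2 * c ^ (p - 2) * K * (|z i₀| ^ (p - 2) *
            (‖z‖ ^ 2 * ‖z‖ ^ (-((N : ℝ) + s * p)))) := by ring
        _ = _ := by rw [h3, neg_sub 2 p]
    · refine ⟨0, max 0 (N + s * p - p), (p - 1) * K ^ (p - 2) * K, by norm_num, le_max_left _ _,
        by rw [zero_add]; exact max_lt (by linarith) (by linarith), fun z hz hzi => ?_⟩
      obtain ⟨ha, hab, -⟩ := hb z hz
      obtain ⟨hb', -, -⟩ := hb (-z) (by rwa [norm_neg])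
      rw [norm_neg] at hb'
      have hzpos : 0 < ‖z‖ := (abs_pos.2 hzi).trans_le (PiLp.norm_apply_le z i₀)
      rw [hfac, abs_mul, abs_of_nonneg (by positivity : 0 ≤ ‖z‖ ^ (-((N : ℝ) + s * p)))]
      set a := 1 - ‖EuclideanSpace.single i₀ (1 : ℝ) - z‖ ^ (-θ)
      set b := 1 - ‖EuclideanSpace.single i₀ (1 : ℝ) - -z‖ ^ (-θ)
      have h1 := abs_signedPow_sub_le_of_two_le hp2 a (-b) ha (by rwa [abs_neg])
      rw [sub_neg_eq_add, Real.mul_rpow hK.le hzpos.le] at h1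
      have hp1 : 0 ≤ p - 1 := by linarith
      have h3 : ‖z‖ ^ (p - 2) * ‖z‖ ^ 2 * ‖z‖ ^ (-((N : ℝ) + s * p)) =
          ‖z‖ ^ (-(N + s * p - p)) := by
        rw [← Real.rpow_natCast, ← Real.rpow_add hzpos, ← Real.rpow_add hzpos]
        congr 1; push_cast; ring
      have h4 : ‖z‖ ^ (-(N + s * p - p)) ≤ ‖z‖ ^ (-(max 0 (N + s * p - p))) :=
        Real.rpow_le_rpow_of_exponent_ge hzpos (by linarith) (neg_le_neg (le_max_right _ _))
      calc _ ≤ (p - 1) * (K ^ (p - 2) * ‖z‖ ^ (p - 2)) * (K * ‖z‖ ^ 2) *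
            ‖z‖ ^ (-((N : ℝ) + s * p)) := by
            gcongr
            exact h1.trans (by gcongr)
        _ = (p - 1) * K ^ (p - 2) * K *
            (‖z‖ ^ (p - 2) * ‖z‖ ^ 2 * ‖z‖ ^ (-((N : ℝ) + s * p))) := by ring
        _ ≤ _ := by rw [h3, neg_zero, Real.rpow_zero, one_mul]; gcongr
  have hsub : {z : EuclideanSpace ℝ (Fin N) | ‖z‖ ≤ 1 / 2} ⊆ {z | ‖z‖ ≤ 1} :=
    fun z (hz : ‖z‖ ≤ 1 / 2) => show ‖z‖ ≤ 1 by linarith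
  have hI := ((integrableOn_coord_rpow_mul_norm_rpow i₀ hα1 hβ hαβ).mono_set hsub).const_mul C
  refine hI.mono' (Measurable.aestronglyMeasurable (by fun_prop)) ?_
  rw [ae_restrict_iff' hms]
  filter_upwards [ae_forall_apply_ne_zero N] with z hzi hz
  exact hle z hz (hzi i₀)

lemma measurable_truncPow (N : ℕ) (θ ε : ℝ) : Measurable (truncPow N θ ε) := by
  unfold truncPow
  exact Measurable.ite (measurableSet_le measurable_const measurable_norm) (by fun_prop)
    measurable_const

lemma truncPow_nonneg (N : ℕ) (θ : ℝ) {ε : ℝ} (hε : 0 < ε) (x : EuclideanSpace ℝ (Fin N)) :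
    0 ≤ truncPow N θ ε x := by
  unfold truncPow; split_ifs <;> positivity

lemma truncPow_le (N : ℕ) {θ ε : ℝ} (hθ : 0 < θ) (hε : 0 < ε) (x : EuclideanSpace ℝ (Fin N)) :
    truncPow N θ ε x ≤ ε ^ (-θ) := by
  unfold truncPow
  split_ifs with h
  · exact Real.rpow_le_rpow_of_nonpos hε h (by linarith)
  · exact le_rfl

lemma exists_pvFracPLap_truncPow_single {N : ℕ} (hN : 2 ≤ N) (i₀ : Fin N) {s p θ : ℝ}
    (hs : 0 < s) (hs1 : s < 1) (hp : 1 < p) (hθ : 0 < θ) :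
    ∃ C : ℝ, ∀ ε : ℝ, 0 < ε → ε ≤ 1 / 2 → ∃ L : ℝ, L ≤ C ∧
      pvFracPLap N s p (truncPow N θ ε) (EuclideanSpace.single i₀ 1) L := by
  set e : EuclideanSpace ℝ (Fin N) := EuclideanSpace.single i₀ (1 : ℝ) with he
  have hen : ‖e‖ = 1 := by simp [he]
  have hsp : 0 < s * p := by positivity
  set Ψ : EuclideanSpace ℝ (Fin N) → ℝ := fun z =>
    |1 - ‖e - z‖ ^ (-θ)| ^ (p - 2) * (1 - ‖e - z‖ ^ (-θ)) * ‖z‖ ^ (-((N : ℝ) + s * p)) with hΨ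
  have hS := integrableOn_symm hN i₀ hs hs1 hp hθ (Ψ := Ψ) (fun z => rfl)
  have hmB : MeasurableSet {z : EuclideanSpace ℝ (Fin N) | ‖z‖ ≤ 1 / 2} :=
    measurableSet_le measurable_norm measurable_const
  have hmA : ∀ r : ℝ, MeasurableSet {z : EuclideanSpace ℝ (Fin N) | r < ‖z‖} :=
    fun r => measurableSet_lt measurable_const measurable_norm
  have htail : ∀ r : ℝ, 0 < r → IntegrableOn
      (fun z : EuclideanSpace ℝ (Fin N) => ‖z‖ ^ (-((N : ℝ) + s * p))) {z | r < ‖z‖} :=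
    fun r hr => integrableOn_norm_rpow_neg_of_lt hsp hr
  refine ⟨1 / 2 * (∫ z in {z : EuclideanSpace ℝ (Fin N) | ‖z‖ ≤ 1 / 2}, (Ψ z + Ψ (-z))) +
    ∫ z in {z : EuclideanSpace ℝ (Fin N) | 1 / 2 < ‖z‖}, ‖z‖ ^ (-((N : ℝ) + s * p)),
    fun ε hε hε2 => ?_⟩
  have hue : truncPow N θ ε e = 1 := by
    rw [truncPow, hen, if_pos (by linarith), Real.one_rpow]
  set g : EuclideanSpace ℝ (Fin N) → ℝ := fun z =>
    |1 - truncPow N θ ε (e - z)| ^ (p - 2) * (1 - truncPow N θ ε (e - z)) *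
      ‖z‖ ^ (-((N : ℝ) + s * p)) with hg
  have hum := measurable_truncPow N θ ε
  have hgm : Measurable g := by fun_prop
  have hgint : ∀ r : ℝ, 0 < r → IntegrableOn g {z | r < ‖z‖} := by
    intro r hr
    refine ((htail r hr).const_mul ((1 + ε ^ (-θ)) ^ (p - 1))).mono' hgm.aestronglyMeasurable
      (ae_of_all _ fun z => ?_)
    rw [Real.norm_eq_abs, hg]
    simp only
    rw [abs_mul, abs_signedPow hp, abs_of_nonneg (by positivity :
      0 ≤ ‖z‖ ^ (-((N : ℝ) + s * p)))]
    have h1 := truncPow_nonneg N θ hε (e - z)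
    have h2 := truncPow_le N hθ hε (e - z)
    gcongr
    rw [abs_le]; constructor <;> linarith
  have hgΨ : ∀ z : EuclideanSpace ℝ (Fin N), ‖z‖ ≤ 1 / 2 → g z = Ψ z := by
    intro z hz
    have h5 : 1 - ‖z‖ ≤ ‖e - z‖ := by rw [← hen]; exact norm_sub_norm_le e z
    simp only [hg, hΨ, truncPow]
    rw [if_pos (by linarith)]
  have hsym : EqOn (fun z => Ψ z + Ψ (-z)) (fun z => g z + g (-z))
      {z : EuclideanSpace ℝ (Fin N) | ‖z‖ ≤ 1 / 2} := by
    intro z (hz : ‖z‖ ≤ 1 / 2)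
    simp only [hgΨ z hz, hgΨ (-z) (by rwa [norm_neg])]
  have hg0 : g 0 = 0 := by simp [hg, hue]
  have hlim := tendsto_integral_of_symm_integrable (by norm_num : (0 : ℝ) < 1 / 2) hgint hg0
    (hS.congr_fun hsym hmB)
  rw [← setIntegral_congr_fun hmB hsym] at hlim
  have hmp : MeasurePreserving (fun y : EuclideanSpace ℝ (Fin N) => e - y) volume volume :=
    Measure.measurePreserving_sub_left volume e
  have hemb : MeasurableEmbedding (fun y : EuclideanSpace ℝ (Fin N) => e - y) :=
    (MeasurableEquiv.subLeft e).measurableEmbedding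
  have hcomp : (fun y => |truncPow N θ ε e - truncPow N θ ε y| ^ (p - 2) *
      (truncPow N θ ε e - truncPow N θ ε y) * ‖e - y‖ ^ (-((N : ℝ) + s * p))) =
      g ∘ fun y => e - y := by
    ext y; simp [hg, hue]
  refine ⟨_, ?_, fun r hr => ?_, hlim.congr fun r => ?_⟩
  · gcongr 1
    refine setIntegral_mono_on (hgint _ (by norm_num)) (htail _ (by norm_num)) (hmA _)
      fun z _ => ?_
    simp only [hg]
    refine mul_le_of_le_one_left (by positivity) ?_
    have h1 := truncPow_nonneg N θ hε (e - z)
    rcases le_total 0 (1 - truncPow N θ ε (e - z)) with h | h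
    · rw [abs_of_nonneg h, rpow_sub_two_mul_self hp h]
      exact Real.rpow_le_one h (by linarith) (by linarith)
    · exact (mul_nonpos_of_nonneg_of_nonpos (by positivity) h).trans zero_le_one
  · rw [hcomp]
    exact (hmp.integrableOn_comp_preimage hemb).2 (hgint r hr)
  · rw [hcomp]
    exact (hmp.setIntegral_preimage_emb hemb g {z | r < ‖z‖}).symm

/-- Behaviour of the fractional `p`-Laplacian under rotations and dilations. -/
lemma pvFracPLap.smul_isometry {N : ℕ} {s p k R L : ℝ} {u w : EuclideanSpace ℝ (Fin N) → ℝ}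
    (U : EuclideanSpace ℝ (Fin N) ≃ₗᵢ[ℝ] EuclideanSpace ℝ (Fin N)) (hp : 1 < p) (hR : 0 < R)
    (hk : 0 < k) (hu : ∀ v, u (R • U v) = k * w v) {e : EuclideanSpace ℝ (Fin N)}
    (h : pvFracPLap N s p w e L) :
    pvFracPLap N s p u (R • U e) (k ^ (p - 1) * R ^ (-(s * p)) * L) := by
  obtain ⟨hint, hlim⟩ := h
  have hmu : ∀ (x : EuclideanSpace ℝ (Fin N)) (r : ℝ),
      MeasurableSet {y : EuclideanSpace ℝ (Fin N) | r < ‖x - y‖} :=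
    fun x r => measurableSet_lt measurable_const (by fun_prop)
  set F : EuclideanSpace ℝ (Fin N) → ℝ := fun y => |u (R • U e) - u y| ^ (p - 2) *
    (u (R • U e) - u y) * ‖R • U e - y‖ ^ (-((N : ℝ) + s * p)) with hF
  set G : EuclideanSpace ℝ (Fin N) → ℝ := fun y => |w e - w y| ^ (p - 2) *
    (w e - w y) * ‖e - y‖ ^ (-((N : ℝ) + s * p)) with hG
  have hnorm : ∀ v, ‖R • U e - R • U v‖ = R * ‖e - v‖ := by
    intro v
    rw [← smul_sub, norm_smul, Real.norm_of_nonneg hR.le, ← map_sub, U.norm_map]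
  have hpt : ∀ v, F (R • U v) = k ^ (p - 1) * R ^ (-((N : ℝ) + s * p)) * G v := by
    intro v
    simp only [hF, hG]
    rw [hnorm, hu, hu, ← mul_sub, abs_mul, abs_of_pos hk, Real.mul_rpow hk.le (abs_nonneg _),
      Real.mul_rpow hR.le (norm_nonneg _), ← rpow_sub_two_mul_self hp hk.le]
    ring
  have hind : ∀ r v, ({y : EuclideanSpace ℝ (Fin N) | r < ‖R • U e - y‖}.indicator F) (R • U v) =
      k ^ (p - 1) * R ^ (-((N : ℝ) + s * p)) *
        ({y : EuclideanSpace ℝ (Fin N) | r / R < ‖e - y‖}.indicator G) v := by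
    intro r v
    have : r < ‖R • U e - R • U v‖ ↔ r / R < ‖e - v‖ := by
      rw [hnorm, div_lt_iff₀ hR, mul_comm]
    by_cases h : r / R < ‖e - v‖
    · rw [indicator_of_mem (by exact this.2 h), indicator_of_mem (by exact h), hpt]
    · rw [indicator_of_notMem (by exact fun h' => h (this.1 h')),
        indicator_of_notMem (by exact h), mul_zero]
  have hUemb : MeasurableEmbedding U := U.toHomeomorph.measurableEmbedding
  constructor
  · intro r hr
    rw [← integrable_indicator_iff (hmu _ r), ← integrable_comp_smul_iff volume _ hR.ne',
      ← U.measurePreserving.integrable_comp_emb hUemb]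
    refine (((integrable_indicator_iff (hmu e (r / R))).2 (hint (r / R) (by positivity))).const_mul
      (k ^ (p - 1) * R ^ (-((N : ℝ) + s * p)))).congr (ae_of_all _ fun v => ?_)
    exact (hind r v).symm
  · have hval : ∀ r, ∫ y in {y : EuclideanSpace ℝ (Fin N) | r < ‖R • U e - y‖}, F y =
        k ^ (p - 1) * R ^ (-(s * p)) *
          ∫ y in {y : EuclideanSpace ℝ (Fin N) | r / R < ‖e - y‖}, G y := by
      intro r
      have h1 := Measure.integral_comp_smul (volume : Measure (EuclideanSpace ℝ (Fin N)))
        ({y : EuclideanSpace ℝ (Fin N) | r < ‖R • U e - y‖}.indicator F) R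
      rw [← U.measurePreserving.integral_comp hUemb] at h1
      simp only [hind] at h1
      rw [integral_const_mul, integral_indicator (hmu _ _), integral_indicator (hmu _ _),
        finrank_euclideanSpace_fin, abs_of_pos (by positivity), smul_eq_mul,
        eq_inv_mul_iff_mul_eq₀ (by positivity)] at h1
      have h2 : R ^ N * R ^ (-((N : ℝ) + s * p)) = R ^ (-(s * p)) := by
        rw [← Real.rpow_natCast, ← Real.rpow_add hR]; congr 1; ring
      rw [← h1, ← h2]
      ring
    refine Tendsto.congr (fun r => (hval r).symm) ((hlim.comp ?_).const_mul _)
    refine tendsto_nhdsWithin_iff.2 ⟨?_, ?_⟩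
    · have : Tendsto (fun r : ℝ => r / R) (nhds 0) (nhds (0 / R)) :=
        tendsto_id.div_const R
      rw [zero_div] at this
      exact this.mono_left nhdsWithin_le_nhds
    · filter_upwards [self_mem_nhdsWithin] with r hr
      exact div_pos hr hR

lemma truncPow_smul_isometry {N : ℕ} {θ R ε : ℝ} (hR : 0 < R) (hε : 0 < ε)
    (U : EuclideanSpace ℝ (Fin N) ≃ₗᵢ[ℝ] EuclideanSpace ℝ (Fin N))
    (v : EuclideanSpace ℝ (Fin N)) :
    truncPow N θ ε (R • U v) = R ^ (-θ) * truncPow N θ (ε / R) v := by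
  have hn : ‖R • U v‖ = R * ‖v‖ := by
    rw [norm_smul, Real.norm_of_nonneg hR.le, U.norm_map]
  simp only [truncPow, hn, div_le_iff₀ hR, mul_comm ‖v‖ R, mul_ite]
  congr 1
  · exact Real.mul_rpow hR.le (norm_nonneg _)
  · rw [← Real.mul_rpow hR.le (by positivity), mul_div_cancel₀ _ hR.ne']

/-- For `θ ∈ (0, (N-sp)/(p-1)]`, the truncated power function with `ε₀ = 1/2` satisfies
`(-Δ_p)^s φ_θ (x) ≤ C |x|^{-θ(p-1)-sp}` for `|x| ≥ 1`, with `C > 0`. -/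
theorem stmt_4 (N : ℕ) (hN : 2 ≤ N) (s p θ : ℝ)
    (hs : 0 < s) (hs1 : s < 1) (hp : 1 < p)
    (hNsp : s * p < N)
    (hθ0 : 0 < θ) (hθ1 : θ ≤ ((N : ℝ) - s * p) / (p - 1)) :
    ∃ C : ℝ, 0 < C ∧ ∀ x : EuclideanSpace ℝ (Fin N), 1 ≤ ‖x‖ →
      ∃ L : ℝ, pvFracPLap N s p (truncPow N θ (1 / 2)) x L ∧
        L ≤ C * ‖x‖ ^ (-θ * (p - 1) - s * p) := by
  set e : EuclideanSpace ℝ (Fin N) := EuclideanSpace.single ⟨0, by omega⟩ (1 : ℝ) with he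
  have hen : ‖e‖ = 1 := by simp [he]
  obtain ⟨C, hC⟩ := exists_pvFracPLap_truncPow_single hN ⟨0, by omega⟩ hs hs1 hp hθ0
  refine ⟨max C 1, by positivity, fun x hx => ?_⟩
  have hR : 0 < ‖x‖ := by linarith
  obtain ⟨L, hLC, hL⟩ := hC (1 / 2 / ‖x‖) (by positivity) (div_le_self (by norm_num) hx)
  have hUe : (ℝ ∙ (e - ‖x‖⁻¹ • x))ᗮ.reflection e = ‖x‖⁻¹ • x :=
    Submodule.reflection_sub (by
      rw [hen, norm_smul, norm_inv, norm_norm, inv_mul_cancel₀ hR.ne'])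
  have hpv := hL.smul_isometry (ℝ ∙ (e - ‖x‖⁻¹ • x))ᗮ.reflection hp hR (by positivity)
    (truncPow_smul_isometry hR (by norm_num) _)
  rw [← he, hUe, smul_inv_smul₀ hR.ne', ← Real.rpow_mul hR.le, ← Real.rpow_add hR,
    ← sub_eq_add_neg] at hpv
  refine ⟨_, hpv, ?_⟩
  rw [mul_comm]
  gcongr
  exact hLC.trans (le_max_left _ _)
end
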